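/- Let (R, 𝔪) be a Noetherian local ring with dim R > 0 and R/𝔪 infinite, let I be a proper ideal, let M be a finitely generated R-module, and let d be a positive integer with dim_R M ≤ d. Then j_d(I, M) = Σ_{𝔭 ∈ Assh_R(M)} length_{R_𝔭}(M_𝔭) · j_d(I, R/𝔭), where Assh_R(M) = { 𝔭 ∈ Ass_R(M) : dim R/𝔭 = dim_R M }. -/

import Mathlib

open Filter

noncomputable section

/-- The length of a module, as the height of `⊤` in the submodule lattice. -/
def mLength (R M : Type*) [CommRing R] [AddCommGroup M] [Module R M] : ℕ∞ :=
  Order.height (⊤ : Submodule R M)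

/-- The Krull dimension of a module, via the annihilator. -/
def mDim (R M : Type*) [CommRing R] [AddCommGroup M] [Module R M] : WithBot ℕ∞ :=
  ringKrullDim (R ⧸ Module.annihilator R M)

/-- `H⁰_I(N)`: elements killed by a power of `I` (0-th local cohomology). -/
def H0 {R : Type*} [CommRing R] (I : Ideal R) (N : Type*) [AddCommGroup N] [Module R N] :
    Submodule R N :=
  ⨆ n : ℕ, Submodule.torsionBySet R N ((I ^ n : Ideal R) : Set R)

/-- `IⁿM/I^{n+1}M`, as a submodule of `M/I^{n+1}M`. -/
def gradedPiece {R : Type*} [CommRing R] (I : Ideal R) {M : Type*} [AddCommGroup M]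
    [Module R M] (n : ℕ) : Submodule R (M ⧸ (I ^ (n + 1) • ⊤ : Submodule R M)) :=
  Submodule.map (I ^ (n + 1) • ⊤ : Submodule R M).mkQ (I ^ n • ⊤ : Submodule R M)

/-- The `j`-multiplicity `j_d(I, M)`, defined as
`lim_n (d−1)!/n^(d−1) · length_R (H⁰_𝔪(IⁿM/I^{n+1}M))`. -/
def jMult {R : Type*} [CommRing R] (𝔪 I : Ideal R) (M : Type*) [AddCommGroup M]
    [Module R M] (d : ℕ) : ℝ :=
  limUnder atTop fun n : ℕ =>
    ((d - 1).factorial : ℝ) / (n : ℝ) ^ (d - 1) *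
      ((mLength R (H0 𝔪 (gradedPiece I (M := M) n))).toNat : ℝ)

/-- The Hilbert–Samuel multiplicity `e(I; N)` of a `d`-dimensional module `N`
(equal to `0` if `N = 0`), defined as `lim_n d!/n^d · length_R (N/IⁿN)`. -/
def hsMult {R : Type*} [CommRing R] (I : Ideal R) (N : Type*) [AddCommGroup N]
    [Module R N] (d : ℕ) : ℝ :=
  limUnder atTop fun n : ℕ =>
    (d.factorial : ℝ) / (n : ℝ) ^ d *
      ((mLength R (N ⧸ (I ^ n • ⊤ : Submodule R N))).toNat : ℝ)

/-- `K :_M I^∞ = ⋃ₙ (K :_M Iⁿ)`. -/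
def satur {R : Type*} [CommRing R] (I : Ideal R) {M : Type*} [AddCommGroup M] [Module R M]
    (K : Submodule R M) : Submodule R M :=
  Submodule.comap K.mkQ (H0 I (M ⧸ K))

/-- "For general elements `a₁, …, aᵢ` of `I`", i.e. for all `i`-tuples of elements of `I`
whose coefficient vectors with respect to any finite generating set of `I` avoid the zero
locus of some nonzero polynomial over the residue field `R/𝔪` (equivalently, whose images
lie in a suitable nonempty Zariski-open set of choices modulo `𝔪I`), property `P` holds. -/
def GeneralElts {R : Type*} [CommRing R] (𝔪 I : Ideal R) (i : ℕ)
    (P : (Fin i → R) → Prop) : Prop :=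
  ∀ (m : ℕ) (x : Fin m → R), Ideal.span (Set.range x) = I →
    ∃ F : MvPolynomial (Fin i × Fin m) R,
      MvPolynomial.map (Ideal.Quotient.mk 𝔪) F ≠ 0 ∧
      ∀ c : Fin i × Fin m → R,
        MvPolynomial.eval (fun p => Ideal.Quotient.mk 𝔪 (c p))
          (MvPolynomial.map (Ideal.Quotient.mk 𝔪) F) ≠ 0 →
        P fun j => ∑ l, c (j, l) * x l

/-- A function `ℕ → ℤ` that eventually agrees with a polynomial of degree less than `d`,
phrased through iterated differences. -/
def EvPoly : ℕ → (ℕ → ℤ) → Prop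
  | 0, f => ∀ᶠ n in atTop, f n = 0
  | d + 1, f => EvPoly d fun n => f (n + 1) - f n

namespace EvPoly

theorem congr : ∀ {d : ℕ} {f g : ℕ → ℤ}, EvPoly d f → (∀ᶠ n in atTop, f n = g n) → EvPoly d g
  | 0, f, g, hf, h => by
    filter_upwards [show ∀ᶠ n in atTop, f n = 0 from hf, h] with n h1 h2
    rw [← h2, h1]
  | d + 1, f, g, hf, h => by
    refine EvPoly.congr (d := d) hf ?_
    filter_upwards [h, (tendsto_add_atTop_nat 1).eventually h] with n h1 h2
    rw [h1, h2]

theorem add : ∀ {d : ℕ} {f g : ℕ → ℤ}, EvPoly d f → EvPoly d g → EvPoly d fun n => f n + g n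
  | 0, f, g, hf, hg => by
    filter_upwards [show ∀ᶠ n in atTop, f n = 0 from hf,
      show ∀ᶠ n in atTop, g n = 0 from hg] with n h1 h2
    rw [h1, h2, add_zero]
  | d + 1, f, g, hf, hg => by
    have h := EvPoly.add (d := d) (f := fun n => f (n + 1) - f n)
      (g := fun n => g (n + 1) - g n) hf hg
    exact EvPoly.congr (d := d) h (Eventually.of_forall fun n => by ring)

theorem mul_left : ∀ {d : ℕ} {f : ℕ → ℤ} (c : ℤ), EvPoly d f → EvPoly d fun n => c * f n
  | 0, f, c, hf => by
    filter_upwards [show ∀ᶠ n in atTop, f n = 0 from hf] with n h1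
    rw [h1, mul_zero]
  | d + 1, f, c, hf => by
    have h := EvPoly.mul_left (d := d) (f := fun n => f (n + 1) - f n) c hf
    exact EvPoly.congr (d := d) h (Eventually.of_forall fun n => by ring)

theorem neg {d : ℕ} {f : ℕ → ℤ} (hf : EvPoly d f) : EvPoly d fun n => - f n :=
  (hf.mul_left (-1)).congr (Eventually.of_forall fun n => by ring)

theorem sub {d : ℕ} {f g : ℕ → ℤ} (hf : EvPoly d f) (hg : EvPoly d g) :
    EvPoly d fun n => f n - g n :=
  (hf.add hg.neg).congr (Eventually.of_forall fun n => by ring)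

theorem shift : ∀ {d : ℕ} {f : ℕ → ℤ}, EvPoly d f → EvPoly d fun n => f (n + 1)
  | 0, f, hf => (tendsto_add_atTop_nat 1).eventually (show ∀ᶠ n in atTop, f n = 0 from hf)
  | d + 1, _, hf => EvPoly.shift (d := d) hf

theorem of_shift : ∀ {d : ℕ} {f : ℕ → ℤ}, EvPoly d (fun n => f (n + 1)) → EvPoly d f
  | 0, f, hf => by
    obtain ⟨N, hN⟩ := eventually_atTop.1 (show ∀ᶠ n in atTop, f (n + 1) = 0 from hf)
    refine eventually_atTop.2 ⟨N + 1, fun n hn => ?_⟩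
    obtain ⟨m, rfl⟩ : ∃ m, n = m + 1 := ⟨n - 1, by omega⟩
    exact hN m (by omega)
  | d + 1, f, hf => EvPoly.of_shift (d := d) (f := fun n => f (n + 1) - f n) hf

theorem succ {d : ℕ} {f : ℕ → ℤ} (hf : EvPoly d f) : EvPoly (d + 1) f :=
  hf.shift.sub hf

theorem mono {d e : ℕ} (h : d ≤ e) {f : ℕ → ℤ} (hf : EvPoly d f) : EvPoly e f := by
  induction h with
  | refl => exact hf
  | step _ ih => exact ih.succ

theorem zero (d : ℕ) : EvPoly d fun _ => 0 :=
  EvPoly.mono (Nat.zero_le d) (show ∀ᶠ _ in atTop, (0 : ℤ) = 0 from Eventually.of_forall fun _ => rfl)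

theorem exists_sum_choose : ∀ {d : ℕ} {f : ℕ → ℤ}, EvPoly d f →
    ∃ (N : ℕ) (c : ℕ → ℤ), ∀ n, f (n + N) = ∑ k ∈ Finset.range d, c k * (n.choose k : ℤ)
  | 0, f, hf => by
    obtain ⟨N, hN⟩ := eventually_atTop.1 (show ∀ᶠ n in atTop, f n = 0 from hf)
    exact ⟨N, 0, fun n => by simpa using hN (n + N) (by omega)⟩
  | d + 1, f, hf => by
    obtain ⟨N, c, hc⟩ := EvPoly.exists_sum_choose (d := d) hf
    refine ⟨N, fun k => if k = 0 then f N else c (k - 1), fun n => ?_⟩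
    induction n with
    | zero => simp [Finset.sum_range_succ']
    | succ n ih =>
      have h1 := hc n
      rw [show n + 1 + N = n + N + 1 by ring, sub_eq_iff_eq_add.1 h1, ih]
      simp only [Finset.sum_range_succ', Nat.choose_succ_succ]
      simp only [Nat.cast_add, mul_add, Finset.sum_add_distrib]
      simp
      ring

theorem tendsto_choose_div (N k d : ℕ) (hk : k ≤ d) :
    Tendsto (fun n : ℕ => (n.choose k : ℝ) / ((n + N : ℕ) : ℝ) ^ d) atTop
      (nhds (if k = d then ((d.factorial : ℝ))⁻¹ else 0)) := by
  have h1 : Tendsto (fun n : ℕ => (n.choose k : ℝ) / (n : ℝ) ^ k) atTop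
      (nhds ((k.factorial : ℝ))⁻¹) := by
    have := (isEquivalent_choose k)
    have h2 := (Asymptotics.isEquivalent_iff_tendsto_one ?_).1 this
    · have h3 := h2.mul_const ((k.factorial : ℝ))⁻¹
      rw [one_mul] at h3
      refine h3.congr' ?_
      filter_upwards [eventually_gt_atTop 0] with n hn
      have : (n : ℝ) ≠ 0 := by positivity
      have : (k.factorial : ℝ) ≠ 0 := by positivity
      simp only [Pi.div_apply]
      field_simp
    · filter_upwards [eventually_gt_atTop 0] with n hn
      have : (0 : ℝ) < n := by exact_mod_cast hn
      positivity
  have h2 : Tendsto (fun n : ℕ => (n : ℝ) / ((n + N : ℕ) : ℝ)) atTop (nhds 1) := by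
    simpa using tendsto_natCast_div_add_atTop (𝕜 := ℝ) (N : ℝ)
  have h3 : Tendsto (fun n : ℕ => (((n + N : ℕ) : ℝ) ^ (d - k))⁻¹) atTop
      (nhds (if k = d then 1 else 0)) := by
    split_ifs with h
    · simp [h]
    · refine Tendsto.inv_tendsto_atTop ?_
      refine (tendsto_pow_atTop (by omega)).comp ?_
      exact tendsto_natCast_atTop_atTop.comp (tendsto_add_atTop_nat N)
  have h4 := (h1.mul (h2.pow k)).mul h3
  have h5 : (k.factorial : ℝ)⁻¹ * 1 ^ k * (if k = d then 1 else 0) =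
      if k = d then ((d.factorial : ℝ))⁻¹ else 0 := by
    split_ifs with h <;> simp [h]
  rw [h5] at h4
  refine h4.congr' ?_
  filter_upwards [eventually_gt_atTop 0] with n hn
  have : (n : ℝ) ≠ 0 := by positivity
  have : ((n + N : ℕ) : ℝ) ≠ 0 := by positivity
  obtain ⟨m, rfl⟩ := Nat.exists_eq_add_of_le hk
  rw [Nat.add_sub_cancel_left, div_pow]
  field_simp
  ring

theorem exists_tendsto {d : ℕ} {f : ℕ → ℤ} (hf : EvPoly (d + 1) f) :
    ∃ c : ℝ, Tendsto (fun n : ℕ => (d.factorial : ℝ) / (n : ℝ) ^ d * (f n : ℝ)) atTop (nhds c) ∧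
      (EvPoly d f → c = 0) := by
  have key : ∀ {e : ℕ} (he : e ≤ d + 1), EvPoly e f → Tendsto
      (fun n : ℕ => (d.factorial : ℝ) / (n : ℝ) ^ d * (f n : ℝ)) atTop
        (nhds 0) ∨ e = d + 1 ∧ ∃ c : ℝ, Tendsto
      (fun n : ℕ => (d.factorial : ℝ) / (n : ℝ) ^ d * (f n : ℝ)) atTop
        (nhds c) := by
    intro e he hf
    obtain ⟨N, c, hc⟩ := hf.exists_sum_choose
    have h : Tendsto (fun n : ℕ => ∑ k ∈ Finset.range e, (d.factorial : ℝ) * c k *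
        ((n.choose k : ℝ) / ((n + N : ℕ) : ℝ) ^ d)) atTop
        (nhds (∑ k ∈ Finset.range e, (d.factorial : ℝ) * c k *
          (if k = d then ((d.factorial : ℝ))⁻¹ else 0))) :=
      tendsto_finsetSum _ fun k hk =>
        (tendsto_choose_div N k d (by have := Finset.mem_range.1 hk; omega)).const_mul _
    have h' : Tendsto (fun n : ℕ => (d.factorial : ℝ) / (n : ℝ) ^ d * (f n : ℝ)) atTop
        (nhds (∑ k ∈ Finset.range e, (d.factorial : ℝ) * c k *
          (if k = d then ((d.factorial : ℝ))⁻¹ else 0))) := by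
      rw [← tendsto_add_atTop_iff_nat N]
      refine h.congr fun n => ?_
      rw [hc n]
      push_cast
      rw [Finset.mul_sum]
      refine Finset.sum_congr rfl fun k _ => ?_
      ring
    rcases Nat.lt_or_ge d e with h1 | h1
    · exact Or.inr ⟨by omega, _, h'⟩
    · left
      convert h'
      symm
      refine Finset.sum_eq_zero fun k hk => ?_
      have := Finset.mem_range.1 hk
      rw [if_neg (by omega), mul_zero]
  have h0 := key le_rfl hf
  obtain ⟨c, hc⟩ : ∃ c : ℝ, Tendsto (fun n : ℕ => (d.factorial : ℝ) / (n : ℝ) ^ d * (f n : ℝ))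
      atTop (nhds c) := by
    rcases h0 with h | ⟨-, h⟩
    · exact ⟨0, h⟩
    · exact h
  refine ⟨c, hc, fun h => ?_⟩
  rcases key (Nat.le_succ d) h with h | ⟨h, -⟩
  · exact tendsto_nhds_unique hc h
  · omega

end EvPoly

section Length
variable {R : Type*} [CommRing R]
variable {M N : Type*} [AddCommGroup M] [Module R M] [AddCommGroup N] [Module R N]

/-- The length of `K / (K ∩ K')`, realised as the image of `K` in `M / K'`. -/
def relLen (K' K : Submodule R M) : ℕ∞ := Module.length R (K.map K'.mkQ)

theorem relLen_map (f : M →ₗ[R] N) (K' : Submodule R N) (K : Submodule R M) :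
    relLen K' (K.map f) = relLen (K'.comap f) K := by
  have hinj : Function.Injective ((K'.comap f).mapQ K' f le_rfl) := by
    rw [← LinearMap.ker_eq_bot, Submodule.ker_mapQ, Submodule.mkQ_map_self]
  have h : (K.map f).map K'.mkQ = (K.map (K'.comap f).mkQ).map ((K'.comap f).mapQ K' f le_rfl) := by
    rw [← Submodule.map_comp, ← Submodule.map_comp]
    rfl
  unfold relLen
  rw [h]
  exact (Submodule.equivMapOfInjective _ hinj _).length_eq.symm

theorem relLen_eq_zero {K' K : Submodule R M} (h : K ≤ K') : relLen K' K = 0 := by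
  have : K.map K'.mkQ = ⊥ := by
    rw [← LinearMap.le_ker_iff_map, Submodule.ker_mkQ]; exact h
  unfold relLen
  rw [this, Module.length_bot]

theorem relLen_add {K₁ K₂ K₃ : Submodule R M} (h₁ : K₁ ≤ K₂) (h₂ : K₂ ≤ K₃) :
    relLen K₁ K₃ = relLen K₁ K₂ + relLen K₂ K₃ := by
  have hle : K₂.map K₁.mkQ ≤ K₃.map K₁.mkQ := Submodule.map_mono h₂
  have hmap : (K₃.map K₁.mkQ).map (Submodule.factor h₁) = K₃.map K₂.mkQ := by
    rw [← Submodule.map_comp]; rfl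
  let g : (K₃.map K₁.mkQ) →ₗ[R] (K₃.map K₂.mkQ) :=
    (Submodule.factor h₁).restrict fun x hx => hmap ▸ Submodule.mem_map_of_mem hx
  refine Module.length_eq_add_of_exact (Submodule.inclusion hle) g
    (Submodule.inclusion_injective hle) ?_ ?_
  · rintro ⟨y, x, hx, rfl⟩
    exact ⟨⟨K₁.mkQ x, x, hx, rfl⟩, Subtype.ext rfl⟩
  · rintro ⟨y, x, hx, rfl⟩
    constructor
    · intro h
      have hx2 : x ∈ K₂ := by
        have := congrArg Subtype.val h
        exact (Submodule.Quotient.mk_eq_zero K₂).1 this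
      exact ⟨⟨_, x, hx2, rfl⟩, rfl⟩
    · rintro ⟨⟨z, w, hw, rfl⟩, hz⟩
      have hz' : K₁.mkQ w = K₁.mkQ x := congrArg Subtype.val hz
      refine Subtype.ext ?_
      change Submodule.factor h₁ (K₁.mkQ x) = 0
      rw [← hz']
      exact (Submodule.Quotient.mk_eq_zero K₂).2 hw

theorem relLen_sup_right (K' K : Submodule R M) : relLen K' (K ⊔ K') = relLen K' K := by
  unfold relLen
  rw [Submodule.map_sup, Submodule.mkQ_map_self, sup_bot_eq]

theorem relLen_inf_left (K' K : Submodule R M) : relLen (K' ⊓ K) K = relLen K' K := by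
  have h := relLen_map K.subtype K' ⊤
  have h' := relLen_map K.subtype (K' ⊓ K) ⊤
  rw [Submodule.map_top, Submodule.range_subtype] at h h'
  rw [h, h', Submodule.comap_inf, Submodule.comap_subtype_self, inf_top_eq]

theorem Module.length_ne_top_of_smul_eq_zero [IsLocalRing R] [Module.Finite R M]
    (h : ∀ r ∈ IsLocalRing.maximalIdeal R, ∀ x : M, r • x = 0) : Module.length R M ≠ ⊤ := by
  have ht : Module.IsTorsionBySet R M (IsLocalRing.maximalIdeal R : Set R) := fun x r => h r r.2 x
  let _ := ht.module
  let _ := Ideal.Quotient.field (IsLocalRing.maximalIdeal R)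
  have : IsScalarTower R (R ⧸ IsLocalRing.maximalIdeal R) M := ht.isScalarTower
  have : Module.Finite (R ⧸ IsLocalRing.maximalIdeal R) M :=
    Module.Finite.of_restrictScalars_finite R _ _
  rw [Module.length_eq_of_surjective (R := R ⧸ IsLocalRing.maximalIdeal R) (S := R)
    (M := M) Ideal.Quotient.mk_surjective]
  exact Module.length_ne_top

theorem relLen_ne_top [IsLocalRing R] [IsNoetherianRing R] [Module.Finite R M] (k : ℕ)
    {K' K : Submodule R M} (h : IsLocalRing.maximalIdeal R ^ k • K ≤ K') : relLen K' K ≠ ⊤ := by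
  induction k generalizing K with
  | zero =>
    rw [pow_zero, Ideal.one_eq_top, Submodule.top_smul] at h
    rw [relLen_eq_zero h]
    exact ENat.zero_ne_top
  | succ k ih =>
    rw [← relLen_sup_right, relLen_add (K₂ := IsLocalRing.maximalIdeal R • K ⊔ K') le_sup_right
      (sup_le_sup_right Submodule.smul_le_right _), relLen_sup_right]
    have h1 := ih (K := IsLocalRing.maximalIdeal R • K) (by rwa [← mul_smul, ← pow_succ])
    refine WithTop.add_ne_top.2 ⟨h1, ?_⟩
    refine Module.length_ne_top_of_smul_eq_zero ?_
    rintro r hr ⟨_, x, hx, rfl⟩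
    refine Subtype.ext ?_
    change Submodule.mkQ _ (r • x) = 0
    rw [Submodule.mkQ_apply, Submodule.Quotient.mk_eq_zero]
    obtain ⟨y, hy, z, hz, rfl⟩ := Submodule.mem_sup.1 hx
    rw [smul_add]
    exact Submodule.add_mem_sup (Submodule.smul_mem_smul hr hy) (K'.smul_mem r hz)

theorem mem_H0 (J : Ideal R) (x : M) : x ∈ H0 J M ↔ ∃ k, ∀ r ∈ J ^ k, r • x = 0 := by
  unfold H0
  rw [Submodule.mem_iSup_of_directed]
  · simp only [Submodule.mem_torsionBySet_iff, Subtype.forall]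
    rfl
  · refine Monotone.directed_le fun a b hab => ?_
    exact Submodule.torsionBySet_le_torsionBySet_of_subset (Ideal.pow_le_pow_right hab)

theorem mem_satur (J : Ideal R) (K : Submodule R M) (x : M) :
    x ∈ satur J K ↔ ∃ k, ∀ r ∈ J ^ k, r • x ∈ K := by
  unfold satur
  rw [Submodule.mem_comap, mem_H0]
  simp only [Submodule.mkQ_apply, ← Submodule.Quotient.mk_smul, Submodule.Quotient.mk_eq_zero]

theorem le_satur (J : Ideal R) (K : Submodule R M) : K ≤ satur J K := fun x hx =>
  (mem_satur J K x).2 ⟨0, fun r _ => K.smul_mem r hx⟩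

theorem satur_mono (J : Ideal R) {K' K : Submodule R M} (h : K' ≤ K) : satur J K' ≤ satur J K :=
  fun x hx => by
    rw [mem_satur] at hx ⊢
    exact hx.imp fun k hk r hr => h (hk r hr)

theorem satur_comap (J : Ideal R) (f : M →ₗ[R] N) (K : Submodule R N) :
    satur J (K.comap f) = (satur J K).comap f := by
  ext x
  simp only [mem_satur, Submodule.mem_comap, map_smul]

/-- The length of the `J`-power torsion of the image of `K` in `M / K'`. -/
def satLen (J : Ideal R) (K' K : Submodule R M) : ℕ∞ := relLen K' (K ⊓ satur J K')

theorem satLen_map (J : Ideal R) (f : M →ₗ[R] N) (K' : Submodule R N) (K : Submodule R M) :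
    satLen J K' (K.map f) = satLen J (K'.comap f) K := by
  have h : K.map f ⊓ satur J K' = (K ⊓ satur J (K'.comap f)).map f := by
    rw [satur_comap]
    exact SetLike.coe_injective (Set.image_inter_preimage _ _ _).symm
  rw [satLen, h, relLen_map, satLen]

theorem satLen_sup_right (J : Ideal R) (K' K : Submodule R M) :
    satLen J K' (K ⊔ K') = satLen J K' K := by
  have h : (K ⊔ K') ⊓ satur J K' = (K ⊓ satur J K') ⊔ K' := by
    rw [sup_comm, sup_inf_assoc_of_le K (le_satur J K'), sup_comm]
  rw [satLen, h, relLen_sup_right, satLen]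

theorem satLen_inf_left (J : Ideal R) (K' K : Submodule R M) :
    satLen J (K' ⊓ K) K = satLen J K' K := by
  have h := satLen_map J K.subtype K' ⊤
  have h' := satLen_map J K.subtype (K' ⊓ K) ⊤
  rw [Submodule.map_top, Submodule.range_subtype] at h h'
  rw [h, h', Submodule.comap_inf, Submodule.comap_subtype_self, inf_top_eq]

theorem length_H0_map_mkQ (J : Ideal R) (K' K : Submodule R M) :
    Module.length R (H0 J (K.map K'.mkQ)) = satLen J K' K := by
  have h : (H0 J (K.map K'.mkQ)).map (K.map K'.mkQ).subtype = (K ⊓ satur J K').map K'.mkQ := by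
    have h1 : (K ⊓ satur J K').map K'.mkQ = K.map K'.mkQ ⊓ H0 J (M ⧸ K') := by
      unfold satur
      exact SetLike.coe_injective (Set.image_inter_preimage K'.mkQ K (H0 J (M ⧸ K')))
    rw [h1]
    ext y
    constructor
    · rintro ⟨x, hx, rfl⟩
      refine ⟨x.2, ?_⟩
      rw [SetLike.mem_coe, mem_H0] at hx ⊢
      obtain ⟨k, hk⟩ := hx
      exact ⟨k, fun r hr => congrArg Subtype.val (hk r hr)⟩
    · rintro ⟨hx1, hx2⟩
      refine ⟨⟨y, hx1⟩, ?_, rfl⟩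
      rw [SetLike.mem_coe, mem_H0] at hx2 ⊢
      obtain ⟨k, hk⟩ := hx2
      exact ⟨k, fun r hr => Subtype.ext (hk r hr)⟩
  unfold satLen relLen
  rw [← h]
  exact (Submodule.equivMapOfInjective _ (Submodule.injective_subtype _) _).length_eq

theorem mLength_eq : mLength R M = Module.length R M := (Module.length_eq_height ..).symm

/-- The length of the zeroth local cohomology of `IⁿM / Iⁿ⁺¹M`. -/
def grLen (J I : Ideal R) (M : Type*) [AddCommGroup M] [Module R M] (n : ℕ) : ℤ :=
  ((satLen J (I ^ (n + 1) • ⊤ : Submodule R M) (I ^ n • ⊤)).toNat : ℤ)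

theorem toNat_mLength_gradedPiece (J I : Ideal R) (n : ℕ) :
    ((mLength R (H0 J (gradedPiece I (M := M) n))).toNat : ℤ) = grLen J I M n := by
  rw [mLength_eq, gradedPiece, length_H0_map_mkQ, grLen]

theorem grLen_congr (J I : Ideal R) (e : M ≃ₗ[R] N) (n : ℕ) : grLen J I M n = grLen J I N n := by
  have h : ∀ m, (I ^ m • ⊤ : Submodule R N) = (I ^ m • ⊤ : Submodule R M).map (e : M →ₗ[R] N) := by
    intro m
    rw [Submodule.map_smul'', Submodule.map_top, LinearEquiv.range]
  rw [grLen, grLen, h n, satLen_map, h (n + 1), Submodule.comap_map_eq_of_injective e.injective]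

end Length

section Filtration
variable {R : Type*} [CommRing R] {I : Ideal R}
variable {M : Type*} [AddCommGroup M] [Module R M]

theorem Ideal.Filtration.coeff_smul_mem (F : I.Filtration M) (r : reesAlgebra I) (i : ℕ) {n : ℕ}
    {y : M} (hy : y ∈ F.N n) : (r : Polynomial R).coeff i • y ∈ F.N (n + i) := by
  rw [add_comm]
  exact F.pow_smul_le i n (Submodule.smul_mem_smul ((mem_reesAlgebra_iff I _).1 r.2 i) hy)

/-- The annihilator in the Rees algebra of the graded module `⨁ F.N n / F'.N n`. -/
def annIdeal (F' F : I.Filtration M) : Ideal (reesAlgebra I) where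
  carrier := {r | ∀ i n, ∀ y ∈ F.N n, (r : Polynomial R).coeff i • y ∈ F'.N (n + i)}
  add_mem' {a b} ha hb i n y hy := by
    rw [Subalgebra.coe_add, Polynomial.coeff_add, add_smul]
    exact add_mem (ha i n y hy) (hb i n y hy)
  zero_mem' i n y _ := by simp
  smul_mem' c x hx i n y hy := by
    rw [smul_eq_mul, Subalgebra.coe_mul, Polynomial.coeff_mul, Finset.sum_smul]
    refine Submodule.sum_mem _ fun p hp => ?_
    replace hp : p.1 + p.2 = i := Finset.HasAntidiagonal.mem_antidiagonal.1 hp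
    rw [mul_smul, ← hp, add_comm p.1, ← add_assoc]
    exact F'.coeff_smul_mem c _ (hx _ _ y hy)

theorem annIdeal_mono {F' F G' G : I.Filtration M} (h' : F' ≤ G') (h : G ≤ F) :
    annIdeal F' F ≤ annIdeal G' G := fun _ hr i n y hy => h' _ (hr i n y (h n hy))

/-- The monomial `a tʲ` of the Rees algebra. -/
def reesMonomial (j : ℕ) (a : R) (ha : a ∈ I ^ j) : reesAlgebra I :=
  ⟨Polynomial.monomial j a, reesAlgebra.monomial_mem.2 ha⟩

theorem reesMonomial_mem_annIdeal {F' F : I.Filtration M} {j : ℕ} {a : R} (ha : a ∈ I ^ j)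
    (h : ∀ n, ∀ y ∈ F.N n, a • y ∈ F'.N (n + j)) : reesMonomial j a ha ∈ annIdeal F' F := by
  intro i n y hy
  simp only [reesMonomial, Polynomial.coeff_monomial]
  split_ifs with hij
  · exact hij ▸ h n y hy
  · simp

theorem mem_annIdeal_of_reesMonomial_mul {F' F : I.Filtration M} {j : ℕ} {a : R} (ha : a ∈ I ^ j)
    (h : ∀ n, ∀ y ∈ F.N n, a • y ∈ F'.N (n + j) → y ∈ F'.N n) (r : reesAlgebra I)
    (hr : reesMonomial j a ha * r ∈ annIdeal F' F) : r ∈ annIdeal F' F := by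
  intro i n y hy
  refine h _ _ (F.coeff_smul_mem r i hy) ?_
  have := hr (i + j) n y hy
  rw [Subalgebra.coe_mul] at this
  change (Polynomial.monomial j a * (r : Polynomial R)).coeff (i + j) • y ∈ _ at this
  rw [Polynomial.coeff_monomial_mul, mul_smul, ← add_assoc] at this
  exact this

theorem ringKrullDim_quotient_mono {S : Type*} [CommRing S] {J K : Ideal S} (h : J ≤ K) :
    ringKrullDim (S ⧸ K) ≤ ringKrullDim (S ⧸ J) :=
  ringKrullDim_le_of_surjective _ (Ideal.Quotient.factor_surjective h)

theorem ringKrullDim_quotient_add_one_le {S : Type*} [CommRing S] {J K : Ideal S} (h : J ≤ K)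
    {x : S} (hx : x ∈ K) (hreg : ∀ r, x * r ∈ J → r ∈ J) :
    ringKrullDim (S ⧸ K) + 1 ≤ ringKrullDim (S ⧸ J) := by
  refine ringKrullDim_succ_le_of_surjective _ (Ideal.Quotient.factor_surjective h)
    (r := Ideal.Quotient.mk J x) ?_ ?_
  · rw [mem_nonZeroDivisors_iff_left]
    intro z hz
    obtain ⟨r, rfl⟩ := Ideal.Quotient.mk_surjective z
    rw [← map_mul, Ideal.Quotient.eq_zero_iff_mem] at hz
    exact Ideal.Quotient.eq_zero_iff_mem.2 (hreg r hz)
  · rw [Ideal.Quotient.factor_mk]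
    exact Ideal.Quotient.eq_zero_iff_mem.2 hx

theorem Ideal.Filtration.single_mem_submodule (F : I.Filtration M) {n : ℕ} {z : M}
    (hz : z ∈ F.N n) : PolynomialModule.single R n z ∈ F.submodule := by
  intro i
  rw [PolynomialModule.coeff_single]
  by_cases hi : n = i
  · subst hi; simpa using hz
  · simp [Ne.symm hi]

variable [IsNoetherianRing R] [Module.Finite R M]

theorem Ideal.Filtration.Stable.isNoetherian {F : I.Filtration M} (hF : F.Stable) :
    IsNoetherian (reesAlgebra I) F.submodule :=
  isNoetherian_of_fg_of_noetherian _
    ((F.submodule_fg_iff_stable fun _ => IsNoetherian.noetherian _).2 hF)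

theorem Ideal.Filtration.Stable.exists_stabilizes {F : I.Filtration M} (hF : F.Stable)
    (T : ℕ → I.Filtration M) (hT : Monotone T) (hle : ∀ k, T k ≤ F) :
    ∃ k₀, ∀ k ≥ k₀, T k = T k₀ := by
  have hN := hF.isNoetherian
  have hmono : Monotone fun k => (T k).submodule.comap F.submodule.subtype := fun a b hab x hx i =>
    hT hab i (hx i)
  obtain ⟨k₀, hk₀⟩ := monotone_stabilizes_iff_noetherian.2 hN ⟨_, hmono⟩
  refine ⟨k₀, fun k hk => ?_⟩
  have h : (T k₀).submodule.comap F.submodule.subtype =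
    (T k).submodule.comap F.submodule.subtype := hk₀ k hk
  refine le_antisymm (fun n y hy => ?_) (hT hk)
  have hy' : (⟨_, F.single_mem_submodule (hle k n hy)⟩ : F.submodule) ∈
      (T k).submodule.comap F.submodule.subtype := (T k).single_mem_submodule hy
  rw [← h] at hy'
  have := hy' n
  simpa [PolynomialModule.coeff_single] using this

theorem Submodule.exists_regular_of_fg {R S P : Type*} [CommRing R] [CommRing S]
    [IsNoetherianRing S] [AddCommGroup P] [Module S P] (φ : R →+* S) (N' N : Submodule S P)
    (hN : N.FG) (J : Ideal R)
    (h : ∀ y ∈ N, (∀ r ∈ J, φ r • y ∈ N') → y ∈ N') :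
    ∃ x ∈ J, ∀ y ∈ N, φ x • y ∈ N' → y ∈ N' := by
  have hN' := isNoetherian_of_fg_of_noetherian _ hN
  let X := N ⧸ N'.comap N.subtype
  have hfin : (associatedPrimes S X).Finite := associatedPrimes.finite _ _
  have hnot : ¬ ((J : Set R) ⊆ ⋃ Q ∈ associatedPrimes S X,
      ((Q.comap φ : Ideal R) : Set R)) := by
    rw [Ideal.subset_union_prime_finite hfin ⊥ ⊥]
    · rintro ⟨Q, hQ, hJ⟩
      obtain ⟨hQp, z, hz⟩ := (isAssociatedPrime_iff_exists_injective_linearMap Q X).1 hQ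
      obtain ⟨⟨f, hf⟩, hfz⟩ := Submodule.Quotient.mk_surjective _ (z 1)
      have h1 : f ∈ N' := by
        refine h f hf fun r hr => ?_
        have h2 : φ r • z 1 = 0 := by
          rw [← map_smul, ← map_zero z]
          congr 1
          rw [Algebra.smul_def, mul_one]
          exact Ideal.Quotient.eq_zero_iff_mem.2 (hJ hr)
        rw [← hfz, ← Submodule.Quotient.mk_smul, Submodule.Quotient.mk_eq_zero] at h2
        exact h2
      have h3 : z 1 = 0 := by
        rw [← hfz, Submodule.Quotient.mk_eq_zero]
        exact h1
      have h4 : (1 : S ⧸ Q) = 0 := hz (by rw [h3, map_zero])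
      exact hQp.ne_top ((Ideal.eq_top_iff_one _).2 (Ideal.Quotient.eq_zero_iff_mem.1 h4))
    · intro Q hQ _ _
      have := hQ.1
      exact Ideal.comap_isPrime _ _
  obtain ⟨x, hxJ, hx⟩ := Set.not_subset.1 hnot
  refine ⟨x, hxJ, fun y hy hxy => ?_⟩
  have hreg : IsSMulRegular X (φ x) := by
    have h1 := biUnion_associatedPrimes_eq_compl_regular S X
    by_contra hc
    have : φ x ∈ {r : S | IsSMulRegular X r}ᶜ := hc
    rw [← h1] at this
    exact hx (by simpa using this)
  have h5 : (Submodule.Quotient.mk ⟨y, hy⟩ : X) = 0 := by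
    refine hreg ?_
    change φ x • _ = φ x • _
    rw [smul_zero, ← Submodule.Quotient.mk_smul, Submodule.Quotient.mk_eq_zero]
    exact hxy
  rw [Submodule.Quotient.mk_eq_zero] at h5
  exact h5

theorem Ideal.Filtration.Stable.exists_regular {F F' : I.Filtration M} (hF : F.Stable)
    (J : Ideal R) (h : ∀ n, ∀ y ∈ F.N n, (∀ r ∈ J, r • y ∈ F'.N n) → y ∈ F'.N n) :
    ∃ x ∈ J, ∀ n, ∀ y ∈ F.N n, x • y ∈ F'.N n → y ∈ F'.N n := by
  have hfg := (F.submodule_fg_iff_stable fun _ => IsNoetherian.noetherian _).2 hF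
  have hsm : ∀ (x : R) (f : PolynomialModule R M) (i : ℕ),
      (algebraMap R (reesAlgebra I) x • f).coeff i = x • f.coeff i := by
    intro x f i
    rw [Subalgebra.smul_def]
    change (Polynomial.C x • f).coeff i = _
    rw [← Polynomial.monomial_zero_left, PolynomialModule.monomial_smul_apply]
    simp
  obtain ⟨x, hxJ, hx⟩ := Submodule.exists_regular_of_fg (algebraMap R (reesAlgebra I))
    F'.submodule F.submodule hfg J fun f hf hJ i => h i _ (hf i) fun r hr => by
      have := hJ r hr i
      rwa [hsm] at this
  refine ⟨x, hxJ, fun n y hy hxy => ?_⟩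
  have := hx _ (F.single_mem_submodule hy) (by
    intro i
    rw [hsm, PolynomialModule.coeff_single]
    by_cases hi : n = i
    · subst hi; simpa using hxy
    · simp [Ne.symm hi]) n
  simpa [PolynomialModule.coeff_single] using this

end Filtration

theorem sup_span_singleton_eq_top_of_ringKrullDim_le_zero {S : Type*} [CommRing S] {J : Ideal S}
    (hJ : ringKrullDim (S ⧸ J) ≤ ((0 : ℕ) : WithBot ℕ∞)) {x : S}
    (hreg : ∀ r, x * r ∈ J → r ∈ J) :
    J ⊔ Ideal.span {x} = ⊤ := by
  by_contra hne
  have := Ideal.Quotient.nontrivial_iff.2 hne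
  have h1 := (ringKrullDim_quotient_add_one_le (le_sup_left : J ≤ J ⊔ Ideal.span {x})
    (Ideal.mem_sup_right (Ideal.mem_span_singleton_self x)) hreg).trans hJ
  have h2 := ringKrullDim_nonneg_of_nontrivial (R := S ⧸ (J ⊔ Ideal.span {x}))
  have h3 : (0 : WithBot ℕ∞) + 1 ≤ ((0 : ℕ) : WithBot ℕ∞) := le_trans (by gcongr) h1
  norm_num at h3

section Hilbert
variable {R : Type*} [CommRing R] {I : Ideal R}
variable {M : Type*} [AddCommGroup M] [Module R M]

theorem relLen_ne_top_of_le {K₁ K₂ K₃ : Submodule R M} (h₁ : K₁ ≤ K₂) (h₂ : K₂ ≤ K₃)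
    (h : relLen K₁ K₃ ≠ ⊤) : relLen K₁ K₂ ≠ ⊤ ∧ relLen K₂ K₃ ≠ ⊤ := by
  rw [relLen_add h₁ h₂] at h
  exact WithTop.add_ne_top.1 h

theorem toNat_relLen_add {K₁ K₂ K₃ : Submodule R M} (h₁ : K₁ ≤ K₂) (h₂ : K₂ ≤ K₃)
    (h : relLen K₁ K₃ ≠ ⊤) :
    ((relLen K₁ K₃).toNat : ℤ) = (relLen K₁ K₂).toNat + (relLen K₂ K₃).toNat := by
  obtain ⟨h₃, h₄⟩ := relLen_ne_top_of_le h₁ h₂ h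
  rw [relLen_add h₁ h₂, ENat.toNat_add h₃ h₄]
  push_cast
  rfl

/-- The elements of `F` multiplied into `F'` by `(a t)ᵏ`. -/
def colonPow (F' F : I.Filtration M) (a : R) (k : ℕ) : I.Filtration M where
  N n := F.N n ⊓ (F'.N (n + k)).comap (LinearMap.lsmul R M (a ^ k))
  mono n := inf_le_inf (F.mono n) (Submodule.comap_mono (by
    rw [add_right_comm]; exact F'.mono (n + k)))
  smul_le n := by
    refine Submodule.smul_le.2 fun r hr y hy => ⟨?_, ?_⟩
    · exact F.smul_le n (Submodule.smul_mem_smul hr hy.1)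
    · change a ^ k • r • y ∈ F'.N (n + 1 + k)
      rw [smul_comm, add_right_comm]
      exact F'.smul_le _ (Submodule.smul_mem_smul hr hy.2)

/-- The filtration `T + (a t) F`. -/
def addShift (T F : I.Filtration M) (a : R) : I.Filtration M where
  N n := T.N n ⊔ (F.N (n - 1)).map (LinearMap.lsmul R M a)
  mono n := sup_le_sup (T.mono n) (Submodule.map_mono (F.antitone (by omega)))
  smul_le n := by
    rw [Submodule.smul_sup, ← Submodule.map_smul'']
    refine sup_le_sup (T.smul_le n) (Submodule.map_mono ?_)
    cases n with
    | zero => exact Submodule.smul_le_right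
    | succ n => exact F.smul_le n

theorem evPoly_relLen_of_regular {d : ℕ} {a : R} (haI : a ∈ I) {U F : I.Filtration M}
    (hUF : U ≤ F) (hF : F.Stable) (hUfin : ∀ n, relLen (U.N n) (F.N n) ≠ ⊤)
    (hUdim : ringKrullDim (reesAlgebra I ⧸ annIdeal U F) ≤ (d : WithBot ℕ∞))
    (hUreg : ∀ n, ∀ y ∈ F.N n, a • y ∈ U.N (n + 1) → y ∈ U.N n)
    (ihd : ∀ e < d, ∀ F' F : I.Filtration M, F' ≤ F → F.Stable →
      (∀ n, relLen (F'.N n) (F.N n) ≠ ⊤) →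
      ringKrullDim (reesAlgebra I ⧸ annIdeal F' F) ≤ (e : WithBot ℕ∞) →
      EvPoly e fun n => ((relLen (F'.N n) (F.N n)).toNat : ℤ)) :
    EvPoly d fun n => ((relLen (U.N n) (F.N n)).toNat : ℤ) := by
  have haI1 : a ∈ I ^ 1 := by rwa [pow_one]
  have hreg := mem_annIdeal_of_reesMonomial_mul (F' := U) (F := F) haI1 hUreg
  cases d with
  | zero =>
    have htop := sup_span_singleton_eq_top_of_ringKrullDim_le_zero hUdim hreg
    have h2 : (1 : reesAlgebra I) ∈ annIdeal U F ⊔ Ideal.span {reesMonomial 1 a haI1} :=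
      htop ▸ Submodule.mem_top
    obtain ⟨r, hr, z, hz, hrz⟩ := Submodule.mem_sup.1 h2
    obtain ⟨c, rfl⟩ := Ideal.mem_span_singleton.1 hz
    have h3 : (r : Polynomial R).coeff 0 = 1 := by
      have h4 := congrArg (fun f : reesAlgebra I => (f : Polynomial R).coeff 0) hrz
      simpa [reesMonomial, Polynomial.mul_coeff_zero, Polynomial.coeff_monomial] using h4
    refine (EvPoly.zero 0).congr (Eventually.of_forall fun n => ?_)
    rw [relLen_eq_zero]
    · rfl
    · intro y hy
      simpa [h3] using hr 0 n y hy
  | succ d =>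
    have haF : ∀ n, (F.N n).map (LinearMap.lsmul R M a) ≤ F.N (n + 1) := by
      rintro n _ ⟨y, hy, rfl⟩
      exact F.smul_le n (Submodule.smul_mem_smul haI hy)
    have hQF : addShift U F a ≤ F := by
      intro n
      refine sup_le (hUF _) ((haF _).trans (F.antitone (by omega)))
    have hUQ : U ≤ addShift U F a := fun n => le_sup_left
    have hQfin : ∀ n, relLen ((addShift U F a).N n) (F.N n) ≠ ⊤ := fun n =>
      (relLen_ne_top_of_le (hUQ n) (hQF n) (hUfin n)).2
    have hdimQ : ringKrullDim (reesAlgebra I ⧸ annIdeal (addShift U F a) F) ≤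
        (d : WithBot ℕ∞) := by
      have h1 := (ringKrullDim_quotient_add_one_le (annIdeal_mono hUQ le_rfl)
        (reesMonomial_mem_annIdeal (F' := addShift U F a) (F := F) haI1 fun n y hy =>
          Submodule.mem_sup_right ⟨y, hy, rfl⟩) hreg).trans hUdim
      exact ENat.WithBot.add_le_add_one_right_iff.1 h1
    have hind := (ihd d (Nat.lt_succ_self d) (addShift U F a) F hQF hF hQfin hdimQ).shift
    refine EvPoly.congr (d := d) hind (Eventually.of_forall fun n => ?_)
    have h1 := toNat_relLen_add (hUQ (n + 1)) (hQF (n + 1)) (hUfin (n + 1))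
    suffices h : relLen (U.N (n + 1)) ((addShift U F a).N (n + 1)) = relLen (U.N n) (F.N n) by
      rw [h] at h1
      exact eq_sub_of_add_eq' h1.symm
    have h2 : (addShift U F a).N (n + 1) =
        (F.N n).map (LinearMap.lsmul R M a) ⊔ U.N (n + 1) := sup_comm _ _
    have h3 : (U.N (n + 1)).comap (LinearMap.lsmul R M a) ⊓ F.N n = U.N n := by
      refine le_antisymm (fun y hy => hUreg n y hy.2 hy.1) (fun y hy => ⟨?_, hUF n hy⟩)
      exact U.smul_le n (Submodule.smul_mem_smul haI hy)
    rw [h2, relLen_sup_right, relLen_map, ← relLen_inf_left, h3]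

variable [IsNoetherianRing R] [Module.Finite R M]

theorem evPoly_relLen (d : ℕ) : ∀ (F' F : I.Filtration M), F' ≤ F → F.Stable →
    (∀ n, relLen (F'.N n) (F.N n) ≠ ⊤) →
    ringKrullDim (reesAlgebra I ⧸ annIdeal F' F) ≤ (d : WithBot ℕ∞) →
    EvPoly d fun n => ((relLen (F'.N n) (F.N n)).toNat : ℤ) := by
  classical
  induction d using Nat.strong_induction_on with | _ d ihd
  suffices H : ∀ (s : Finset R) (J : Ideal R) (F' F : I.Filtration M), (s : Set R) ⊆ I →
      I ≤ Ideal.span s ⊔ J → (∀ n, J • F.N n ≤ F'.N (n + 1)) → F' ≤ F → F.Stable →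
      (∀ n, relLen (F'.N n) (F.N n) ≠ ⊤) →
      ringKrullDim (reesAlgebra I ⧸ annIdeal F' F) ≤ (d : WithBot ℕ∞) →
      EvPoly d fun n => ((relLen (F'.N n) (F.N n)).toNat : ℤ) by
    intro F' F
    obtain ⟨s, hs⟩ := (IsNoetherian.noetherian I : I.FG)
    exact H s ⊥ F' F (hs ▸ Submodule.subset_span) (by rw [← hs]; exact le_sup_left)
      (fun n => by simp)
  intro s
  induction s using Finset.induction_on with
  | empty =>
    intro J F' F _ hI hJ hle hF _ _
    rw [Finset.coe_empty, Ideal.span_empty, bot_sup_eq] at hI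
    refine (EvPoly.zero d).congr ?_
    obtain ⟨n₀, hn₀⟩ := hF
    refine eventually_atTop.2 ⟨n₀ + 1, fun n hn => ?_⟩
    obtain ⟨m, rfl⟩ : ∃ m, n = m + 1 := ⟨n - 1, by omega⟩
    rw [relLen_eq_zero]
    · rfl
    · rw [← hn₀ m (by omega)]
      exact (Submodule.smul_mono_left hI).trans (hJ m)
  | insert a s _ ihs =>
    intro J F' F hsI hI hJ hle hF hfin hdim
    have haI : a ∈ I := hsI (by simp)
    have hsI' : (s : Set R) ⊆ I := fun x hx => hsI (by simp [Finset.mem_coe.1 hx])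
    let T := colonPow F' F a
    have hTmem : ∀ {k n : ℕ} {y : M}, y ∈ (T k).N n ↔ y ∈ F.N n ∧ a ^ k • y ∈ F'.N (n + k) := Iff.rfl
    have hTF : ∀ k, T k ≤ F := fun k n y hy => hy.1
    have hT : Monotone T := monotone_nat_of_le_succ fun k n y hy => hTmem.2 ⟨hy.1, by
      rw [pow_succ', mul_smul, ← add_assoc]
      exact F'.smul_le _ (Submodule.smul_mem_smul haI hy.2)⟩
    have hF'T : ∀ k, F' ≤ T k := fun k n y hy => hTmem.2 ⟨hle n hy, by
      rw [add_comm]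
      exact F'.pow_smul_le k n (Submodule.smul_mem_smul (Ideal.pow_mem_pow haI k) hy)⟩
    have hT0 : T 0 = F' := le_antisymm (fun n y hy => by simpa using hy.2) (hF'T 0)
    obtain ⟨k₀, hk₀⟩ := hF.exists_stabilizes T hT hTF
    have hstep : ∀ k, EvPoly d fun n => ((relLen ((T k).N n) ((T (k + 1)).N n)).toNat : ℤ) := by
      intro k
      refine ihs (J ⊔ Ideal.span {a}) (T k) (T (k + 1)) hsI' ?_ ?_ (hT (Nat.le_succ k))
        (hF.of_le (hTF _)) ?_ ?_
      · refine hI.trans ?_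
        rw [Finset.coe_insert, Ideal.span_insert]
        refine sup_le (sup_le ?_ le_sup_left) (le_sup_left.trans le_sup_right)
        exact le_sup_right.trans le_sup_right
      · intro n
        rw [Submodule.sup_smul]
        refine sup_le ?_ ?_
        · exact (smul_mono_right _ (hTF _ n)).trans ((hJ n).trans (hF'T k (n + 1)))
        · rw [Submodule.ideal_span_singleton_smul]
          rintro _ ⟨y, hy, rfl⟩
          refine hTmem.2 ⟨F.smul_le n (Submodule.smul_mem_smul haI hy.1), ?_⟩
          change a ^ k • a • y ∈ F'.N (n + 1 + k)
          rw [← mul_smul, ← pow_succ, add_assoc, add_comm 1]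
          exact hy.2
      · intro n
        exact (relLen_ne_top_of_le (hT (Nat.le_succ k) n) (hTF (k + 1) n)
          (relLen_ne_top_of_le (hF'T k n) (hTF k n) (hfin n)).2).1
      · exact (ringKrullDim_quotient_mono (annIdeal_mono (hF'T k) (hTF _))).trans hdim
    have hsum : ∀ k, EvPoly d fun n => ((relLen (F'.N n) ((T k).N n)).toNat : ℤ) := by
      intro k
      induction k with
      | zero =>
        refine (EvPoly.zero d).congr (Eventually.of_forall fun n => ?_)
        rw [hT0, relLen_eq_zero le_rfl]
        rfl
      | succ k ih =>
        refine (ih.add (hstep k)).congr (Eventually.of_forall fun n => ?_)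
        exact (toNat_relLen_add (hF'T k n) (hT (Nat.le_succ k) n)
          (relLen_ne_top_of_le (hF'T _ n) (hTF _ n) (hfin n)).1).symm
    suffices hlast : EvPoly d fun n => ((relLen ((T k₀).N n) (F.N n)).toNat : ℤ) from
      ((hsum k₀).add hlast).congr (Eventually.of_forall fun n =>
        (toNat_relLen_add (hF'T k₀ n) (hTF k₀ n) (hfin n)).symm)
    obtain ⟨U, hU⟩ : ∃ U, U = T k₀ := ⟨_, rfl⟩
    rw [← hU]
    have hUF : U ≤ F := hU ▸ hTF k₀
    have hUreg : ∀ n, ∀ y ∈ F.N n, a • y ∈ U.N (n + 1) → y ∈ U.N n := by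
      intro n y hy hay
      rw [hU, ← hk₀ (k₀ + 1) (Nat.le_succ _)]
      refine hTmem.2 ⟨hy, ?_⟩
      rw [hU] at hay
      have h1 := (hTmem.1 hay).2
      rw [← mul_smul, ← pow_succ, add_assoc, add_comm 1] at h1
      exact h1
    have hF'U : F' ≤ U := hU ▸ hF'T k₀
    have hUfin : ∀ n, relLen (U.N n) (F.N n) ≠ ⊤ := fun n =>
      (relLen_ne_top_of_le (hF'U n) (hUF n) (hfin n)).2
    have hUdim : ringKrullDim (reesAlgebra I ⧸ annIdeal U F) ≤ (d : WithBot ℕ∞) :=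
      (ringKrullDim_quotient_mono (annIdeal_mono hF'U le_rfl)).trans hdim
    exact evPoly_relLen_of_regular haI hUF hF hUfin hUdim hUreg ihd

end Hilbert

section Adjoin
variable {R D : Type*} [CommRing R] [CommRing D] [Algebra R D]

theorem exists_surjective_adjoin_insert (s : Set D) (b : D) :
    ∃ f : Polynomial (Algebra.adjoin R s) →+* Algebra.adjoin R (insert b s),
      Function.Surjective f ∧ ∀ q, (f q : D) = Polynomial.aeval b q := by
  have h : (Algebra.adjoin R (insert b s) : Set D) =
      ((Polynomial.aeval b : Polynomial (Algebra.adjoin R s) →ₐ[Algebra.adjoin R s] D).range :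
        Set D) := by
    rw [← Algebra.adjoin_singleton_eq_range_aeval, Set.insert_eq, Set.union_comm,
      Algebra.adjoin_union_eq_adjoin_adjoin]
    rfl
  have hm : ∀ q : Polynomial (Algebra.adjoin R s),
      Polynomial.aeval b q ∈ Algebra.adjoin R (insert b s) := fun q => by
    rw [← SetLike.mem_coe, h]
    exact ⟨q, rfl⟩
  refine ⟨((Polynomial.aeval b : Polynomial (Algebra.adjoin R s) →ₐ[Algebra.adjoin R s] D) :
    Polynomial (Algebra.adjoin R s) →+* D).codRestrict _ hm, ?_, fun q => rfl⟩
  rintro ⟨x, hx⟩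
  rw [← SetLike.mem_coe, h] at hx
  obtain ⟨q, hq⟩ := hx
  exact ⟨q, Subtype.ext hq⟩

variable [IsNoetherianRing R]

theorem isNoetherianRing_adjoin_of_finite {s : Set D} (hs : s.Finite) :
    IsNoetherianRing (Algebra.adjoin R s) := by
  have := (Subalgebra.fg_iff_finiteType (Algebra.adjoin R s)).1 ⟨hs.toFinset, by simp⟩
  exact Algebra.FiniteType.isNoetherianRing R _

theorem ringKrullDim_adjoin_insert_le {s : Set D} (hs : s.Finite) (b : D) :
    ringKrullDim (Algebra.adjoin R (insert b s)) ≤ ringKrullDim (Algebra.adjoin R s) + 1 := by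
  have := isNoetherianRing_adjoin_of_finite (R := R) hs
  obtain ⟨f, hf, -⟩ := exists_surjective_adjoin_insert (R := R) s b
  rw [← Polynomial.ringKrullDim_of_isNoetherianRing]
  exact ringKrullDim_le_of_surjective f hf

theorem ringKrullDim_adjoin_insert_le_of_mul_mem [IsDomain D] {s : Set D} (hs : s.Finite) (b : D)
    {c : D} (hc0 : c ≠ 0) (hc : c ∈ Algebra.adjoin R s) (hcb : c * b ∈ Algebra.adjoin R s) :
    ringKrullDim (Algebra.adjoin R (insert b s)) ≤ ringKrullDim (Algebra.adjoin R s) := by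
  have := isNoetherianRing_adjoin_of_finite (R := R) hs
  obtain ⟨f, hf, hfe⟩ := exists_surjective_adjoin_insert (R := R) s b
  have h := ringKrullDim_succ_le_of_surjective f hf
    (r := Polynomial.C ⟨c, hc⟩ * Polynomial.X - Polynomial.C ⟨c * b, hcb⟩)
    (mem_nonZeroDivisors_of_ne_zero fun h => ?_) ?_
  · rw [Polynomial.ringKrullDim_of_isNoetherianRing] at h
    exact ENat.WithBot.add_le_add_one_right_iff.1 h
  · have := congrArg (Polynomial.coeff · 1) h
    simp only [Polynomial.coeff_sub, Polynomial.coeff_C_mul, Polynomial.coeff_X_one, mul_one,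
      Polynomial.coeff_C_succ, sub_zero, Polynomial.coeff_zero] at this
    exact hc0 (congrArg Subtype.val this)
  · apply Subtype.ext
    rw [hfe]
    simp

end Adjoin

section Dim
variable {R : Type*} [CommRing R]

/-- The map from the Rees algebra to the polynomial ring over `R / p`. -/
def reesQuotientMap (I p : Ideal R) : reesAlgebra I →ₐ[R] Polynomial (R ⧸ p) :=
  (Polynomial.mapAlgHom (Ideal.Quotient.mkₐ R p)).comp (reesAlgebra I).val

theorem coeff_reesQuotientMap (I p : Ideal R) (f : reesAlgebra I) (i : ℕ) :
    (reesQuotientMap I p f).coeff i = Ideal.Quotient.mk p ((f : Polynomial R).coeff i) := by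
  simp [reesQuotientMap, Polynomial.coe_mapAlgHom, Polynomial.coeff_map]

theorem mem_ker_reesQuotientMap (I p : Ideal R) (f : reesAlgebra I) :
    f ∈ RingHom.ker (reesQuotientMap I p) ↔ ∀ i, (f : Polynomial R).coeff i ∈ p := by
  rw [RingHom.mem_ker, Polynomial.ext_iff]
  simp only [coeff_reesQuotientMap, Polynomial.coeff_zero, Ideal.Quotient.eq_zero_iff_mem]

theorem range_reesQuotientMap [IsNoetherianRing R] (I p : Ideal R) : ∃ T : Finset R,
    Ideal.span (T : Set R) = I ∧ (reesQuotientMap I p).range = Algebra.adjoin R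
      ((fun c => Polynomial.monomial 1 (Ideal.Quotient.mk p c)) '' (T : Set R)) := by
  obtain ⟨T, hT⟩ := (isNoetherianRing_iff_ideal_fg R).1 ‹_› I
  refine ⟨T, hT, ?_⟩
  rw [reesQuotientMap, AlgHom.range_comp, Subalgebra.range_val, ← adjoin_monomial_eq_reesAlgebra]
  nth_rewrite 1 [← hT]
  rw [← Ideal.submodule_span_eq, Submodule.map_span, Algebra.adjoin_span, AlgHom.map_adjoin,
    Set.image_image]
  simp [Polynomial.coe_mapAlgHom, Polynomial.map_monomial]

theorem ringKrullDim_adjoin_empty_le (p : Ideal R) :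
    ringKrullDim (Algebra.adjoin R (∅ : Set (Polynomial (R ⧸ p)))) ≤ ringKrullDim (R ⧸ p) := by
  let f : (R ⧸ p) →+* (Algebra.adjoin R (∅ : Set (Polynomial (R ⧸ p)))) :=
    (Polynomial.C).codRestrict _ fun x => by
      obtain ⟨x, rfl⟩ := Ideal.Quotient.mk_surjective x
      exact Subalgebra.algebraMap_mem _ x
  refine ringKrullDim_le_of_surjective f ?_
  rintro ⟨x, hx⟩
  rw [Algebra.adjoin_empty] at hx
  obtain ⟨r, rfl⟩ := hx
  exact ⟨Ideal.Quotient.mk p r, rfl⟩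

theorem ringKrullDim_quotient_ker_reesQuotientMap_le [IsNoetherianRing R] {I p : Ideal R}
    [p.IsPrime] {a : R} (ha : a ∈ I) (hap : a ∉ p) :
    ringKrullDim (reesAlgebra I ⧸ RingHom.ker (reesQuotientMap I p)) ≤
      ringKrullDim (R ⧸ p) + 1 := by
  classical
  obtain ⟨T, hT, hr⟩ := range_reesQuotientMap I p
  rw [ringKrullDim_eq_of_ringEquiv (Ideal.quotientKerEquivRange (reesQuotientMap I p)).toRingEquiv]
  let g : R → Polynomial (R ⧸ p) := fun c => Polynomial.monomial 1 (Ideal.Quotient.mk p c)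
  obtain ⟨b, hbT, hbp⟩ : ∃ b ∈ T, b ∉ p := by
    by_contra! h
    exact hap ((Ideal.span_le.2 h) (hT ▸ ha))
  have key : ∀ U : Finset R, ringKrullDim (Algebra.adjoin R (insert (g b) (g '' (U : Set R)))) ≤
      ringKrullDim (R ⧸ p) + 1 := by
    intro U
    induction U using Finset.induction_on with
    | empty =>
      rw [Finset.coe_empty, Set.image_empty]
      refine (ringKrullDim_adjoin_insert_le Set.finite_empty _).trans ?_
      gcongr
      exact ringKrullDim_adjoin_empty_le p
    | insert c U _ ih =>
      rw [Finset.coe_insert, Set.image_insert_eq, Set.insert_comm]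
      refine (ringKrullDim_adjoin_insert_le_of_mul_mem (U.finite_toSet.image g |>.insert _) (g c)
        (c := algebraMap R _ b) ?_ (Subalgebra.algebraMap_mem _ _) ?_).trans ih
      · rw [Polynomial.algebraMap_apply, Ideal.Quotient.algebraMap_eq, Ne, Polynomial.C_eq_zero,
          Ideal.Quotient.eq_zero_iff_mem]
        exact hbp
      · have : algebraMap R (Polynomial (R ⧸ p)) b * g c = c • g b := by
          rw [Polynomial.algebraMap_apply, Ideal.Quotient.algebraMap_eq, Algebra.smul_def,
            Polynomial.algebraMap_apply, Ideal.Quotient.algebraMap_eq, Polynomial.C_mul_monomial,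
            Polynomial.C_mul_monomial, mul_comm]
        rw [this]
        exact Subalgebra.smul_mem _ (Algebra.subset_adjoin (Set.mem_insert _ _)) _
  have h := key T
  rwa [Set.insert_eq_of_mem (Set.mem_image_of_mem g hbT), ← hr] at h

theorem ringKrullDim_le_of_ker_reesQuotientMap_le [IsNoetherianRing R] {I p : Ideal R}
    [p.IsPrime] {Q : Ideal (reesAlgebra I)} (hI : ∀ a ∈ I, algebraMap R _ a ∈ Q)
    (hp : RingHom.ker (reesQuotientMap I p) ≤ Q) :
    ringKrullDim (reesAlgebra I ⧸ Q) ≤ ringKrullDim (R ⧸ p) := by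
  by_cases h : I ≤ p
  · have hpQ : ∀ x ∈ p, (algebraMap R (reesAlgebra I)) x ∈ Q := fun x hx => by
      apply hp
      rw [mem_ker_reesQuotientMap]
      intro i
      change (Polynomial.C x).coeff i ∈ p
      rw [Polynomial.coeff_C]
      split_ifs
      exacts [hx, zero_mem _]
    refine ringKrullDim_le_of_surjective (Ideal.quotientMap Q (algebraMap R (reesAlgebra I)) hpQ) ?_
    intro y
    obtain ⟨f, rfl⟩ := Ideal.Quotient.mk_surjective y
    refine ⟨Ideal.Quotient.mk p ((f : Polynomial R).coeff 0), ?_⟩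
    refine Ideal.Quotient.eq.2 ?_
    apply hp
    rw [mem_ker_reesQuotientMap]
    intro i
    change (Polynomial.C ((f : Polynomial R).coeff 0) - (f : Polynomial R)).coeff i ∈ p
    rw [Polynomial.coeff_sub]
    cases i with
    | zero => simp
    | succ i =>
      rw [Polynomial.coeff_C_succ, zero_sub, neg_mem_iff]
      exact h (Ideal.pow_le_self (Nat.succ_ne_zero i) ((mem_reesAlgebra_iff I _).1 f.2 (i + 1)))
  · obtain ⟨a, ha, hap⟩ := SetLike.not_le_iff_exists.1 h
    have h1 := ringKrullDim_quotient_add_one_le hp (hI a ha) fun r hr => by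
      rw [RingHom.mem_ker, map_mul, mul_eq_zero] at hr
      refine hr.resolve_left fun h0 => hap ?_
      have := (mem_ker_reesQuotientMap I p _).1 h0 0
      change (Polynomial.C a).coeff 0 ∈ p at this
      rwa [Polynomial.coeff_C_zero] at this
    exact ENat.WithBot.add_le_add_one_right_iff.1
      (h1.trans (ringKrullDim_quotient_ker_reesQuotientMap_le ha hap))

theorem exists_minimalPrimes_ker_reesQuotientMap_le [IsNoetherianRing R] {I J : Ideal R}
    {Q : Ideal (reesAlgebra I)} [Q.IsPrime]
    (hJ : ∀ f : reesAlgebra I, (∀ i, (f : Polynomial R).coeff i ∈ J) → f ∈ Q) :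
    ∃ p ∈ J.minimalPrimes, RingHom.ker (reesQuotientMap I p) ≤ Q := by
  have hfin := Ideal.finite_minimalPrimes_of_isNoetherianRing R J
  have h : hfin.toFinset.inf (fun p => RingHom.ker (reesQuotientMap I p)) ≤ Q := by
    obtain ⟨k, hk⟩ := J.exists_radical_pow_le_of_fg ((isNoetherianRing_iff_ideal_fg R).1 ‹_› _)
    intro f hf
    rw [Submodule.mem_finsetInf] at hf
    refine ‹Q.IsPrime›.mem_of_pow_mem k (hJ _ fun i => ?_)
    have h1 : (f : Polynomial R) ∈ J.radical.map Polynomial.C := by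
      rw [Ideal.mem_map_C_iff]
      intro i
      rw [← Ideal.sInf_minimalPrimes, Ideal.mem_sInf]
      intro p hp
      exact (mem_ker_reesQuotientMap I p f).1 (hf p (hfin.mem_toFinset.2 hp)) i
    have h2 : (f : Polynomial R) ^ k ∈ J.map Polynomial.C := by
      have := Ideal.pow_mem_pow h1 k
      rw [← Ideal.map_pow] at this
      exact Ideal.map_mono hk this
    exact Ideal.mem_map_C_iff.1 h2 i
  obtain ⟨p, hp, hpQ⟩ := (Ideal.IsPrime.inf_le' ‹_›).1 h
  exact ⟨p, hfin.mem_toFinset.1 hp, hpQ⟩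

theorem ringKrullDim_quotient_le_of_forall_prime {S : Type*} [CommRing S] {K : Ideal S}
    {b : WithBot ℕ∞} (h : ∀ Q : Ideal S, Q.IsPrime → K ≤ Q → ringKrullDim (S ⧸ Q) ≤ b) :
    ringKrullDim (S ⧸ K) ≤ b := by
  rw [ringKrullDim_quotient, Order.krullDim]
  refine iSup_le fun l => ?_
  refine le_trans ?_ (h l.head.1.asIdeal l.head.1.2 l.head.2)
  rw [ringKrullDim_quotient]
  let l' : LTSeries (PrimeSpectrum.zeroLocus (l.head.1.asIdeal : Set S)) :=
    { length := l.length
      toFun := fun i => ⟨(l i).1, l.head_le i⟩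
      step := fun i => l.step i }
  exact Order.LTSeries.length_le_krullDim l'

theorem ringKrullDim_quotient_reesAlgebra_le [IsNoetherianRing R] {I J : Ideal R}
    {K : Ideal (reesAlgebra I)} (hI : ∀ a ∈ I, algebraMap R _ a ∈ K)
    (hJ : ∀ f : reesAlgebra I, (∀ i, (f : Polynomial R).coeff i ∈ J) → f ∈ K) :
    ringKrullDim (reesAlgebra I ⧸ K) ≤ ringKrullDim (R ⧸ J) := by
  refine ringKrullDim_quotient_le_of_forall_prime fun Q hQ hKQ => ?_
  obtain ⟨p, hp, hpQ⟩ := exists_minimalPrimes_ker_reesQuotientMap_le (J := J) (Q := Q)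
    fun f hf => hKQ (hJ f hf)
  have := hp.1.1
  exact (ringKrullDim_le_of_ker_reesQuotientMap_le (fun a ha => hKQ (hI a ha)) hpQ).trans
    (ringKrullDim_quotient_mono hp.1.2)

theorem ringKrullDim_quotient_annIdeal_le [IsNoetherianRing R] {I : Ideal R} {M : Type*}
    [AddCommGroup M] [Module R M] {F' F : I.Filtration M} (h : ∀ n, I • F.N n ≤ F'.N n) :
    ringKrullDim (reesAlgebra I ⧸ annIdeal F' F) ≤ mDim R M := by
  refine ringKrullDim_quotient_reesAlgebra_le (fun a ha i n y hy => ?_) fun f hf i n y _ => ?_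
  · change (Polynomial.C a).coeff i • y ∈ _
    rw [Polynomial.coeff_C]
    split_ifs with hi
    · rw [hi]
      exact h n (Submodule.smul_mem_smul ha hy)
    · simp
  · rw [Module.mem_annihilator.1 (hf i)]
    exact zero_mem _

end Dim

section Additivity
variable {R : Type*} [CommRing R] {I : Ideal R}
variable {M : Type*} [AddCommGroup M] [Module R M]

/-- The filtration `F ∩ (F' : J^∞)`. -/
def satFiltration (J : Ideal R) (F' F : I.Filtration M) : I.Filtration M where
  N n := F.N n ⊓ satur J (F'.N n)
  mono n := inf_le_inf (F.mono n) (satur_mono J (F'.mono n))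
  smul_le n := by
    rw [Submodule.smul_le]
    rintro r hr x ⟨hx, hx'⟩
    refine ⟨F.smul_le n (Submodule.smul_mem_smul hr hx), ?_⟩
    obtain ⟨k, hk⟩ := (mem_satur J _ x).1 hx'
    refine (mem_satur J _ _).2 ⟨k, fun s hs => ?_⟩
    rw [smul_comm]
    exact F'.smul_le n (Submodule.smul_mem_smul hr (hk s hs))

theorem satFiltration_le (J : Ideal R) (F' F : I.Filtration M) : satFiltration J F' F ≤ F :=
  fun _ _ hx => hx.1

theorem le_satFiltration (J : Ideal R) {F' F : I.Filtration M} (h : F' ≤ F) :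
    F' ≤ satFiltration J F' F := fun n _ hx => ⟨h n hx, le_satur J _ hx⟩

/-- The filtration `F ∩ (F' : T)`. -/
def colonFiltration (T : Ideal R) (F' F : I.Filtration M) : I.Filtration M where
  N n :=
    { carrier := {y | y ∈ F.N n ∧ ∀ r ∈ T, r • y ∈ F'.N n}
      add_mem' := fun ha hb => ⟨add_mem ha.1 hb.1, fun r hr => by
        rw [smul_add]; exact add_mem (ha.2 r hr) (hb.2 r hr)⟩
      zero_mem' := ⟨zero_mem _, fun r _ => by rw [smul_zero]; exact zero_mem _⟩
      smul_mem' := fun c x hx => ⟨Submodule.smul_mem _ c hx.1, fun r hr => by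
        rw [smul_comm]; exact Submodule.smul_mem _ c (hx.2 r hr)⟩ }
  mono n _ hx := ⟨F.mono n hx.1, fun r hr => F'.mono n (hx.2 r hr)⟩
  smul_le n := by
    rw [Submodule.smul_le]
    rintro r hr x ⟨hx, hx'⟩
    refine ⟨F.smul_le n (Submodule.smul_mem_smul hr hx), fun s hs => ?_⟩
    rw [smul_comm]
    exact F'.smul_le n (Submodule.smul_mem_smul hr (hx' s hs))

variable [IsNoetherianRing R] [Module.Finite R M]

theorem Ideal.Filtration.Stable.exists_pow_smul_satFiltration_le {F : I.Filtration M}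
    (hF : F.Stable) (J : Ideal R) (F' : I.Filtration M) :
    ∃ k, ∀ n, J ^ k • (satFiltration J F' F).N n ≤ F'.N n := by
  let T : ℕ → I.Filtration M := fun k => colonFiltration (J ^ k) F' F
  have hmono : Monotone T := fun a b hab n y hy =>
    ⟨hy.1, fun r hr => hy.2 r (Ideal.pow_le_pow_right hab hr)⟩
  obtain ⟨k, hk⟩ := hF.exists_stabilizes T hmono fun k n y hy => hy.1
  refine ⟨k, fun n => ?_⟩
  rw [Submodule.smul_le]
  rintro r hr x ⟨hx, hx'⟩
  obtain ⟨l, hl⟩ := (mem_satur J _ x).1 hx'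
  have h1 : x ∈ (T (max l k)).N n := hmono (le_max_left l k) n ⟨hx, hl⟩
  rw [hk _ (le_max_right l k)] at h1
  exact h1.2 r hr

variable [IsLocalRing R]

local notation "𝔪" => IsLocalRing.maximalIdeal R

/-- The Hilbert function of the zeroth local cohomology of `⨁ F.N n / F'.N n`. -/
def filtLen (F' F : I.Filtration M) (n : ℕ) : ℤ := ((satLen 𝔪 (F'.N n) (F.N n)).toNat : ℤ)

theorem Ideal.Filtration.Stable.relLen_satFiltration_ne_top {F : I.Filtration M}
    (hF : F.Stable) (F' : I.Filtration M) (n : ℕ) :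
    relLen (F'.N n) ((satFiltration 𝔪 F' F).N n) ≠ ⊤ := by
  obtain ⟨k, hk⟩ := hF.exists_pow_smul_satFiltration_le 𝔪 F'
  exact relLen_ne_top k (hk n)

theorem evPoly_filtLen {d : ℕ} {F' F : I.Filtration M} (h : F' ≤ F) (hF : F.Stable)
    (hd : ringKrullDim (reesAlgebra I ⧸ annIdeal F' F) ≤ (d : WithBot ℕ∞)) :
    EvPoly d (filtLen F' F) :=
  evPoly_relLen d F' (satFiltration 𝔪 F' F) (le_satFiltration 𝔪 h)
    (hF.of_le (satFiltration_le 𝔪 F' F)) (hF.relLen_satFiltration_ne_top F')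
    ((ringKrullDim_quotient_mono (annIdeal_mono le_rfl (satFiltration_le 𝔪 F' F))).trans hd)

theorem filtLen_add_sub {F'' F' F : I.Filtration M} (h₁ : F'' ≤ F') (h₂ : F' ≤ F)
    (hF : F.Stable) (n : ℕ) :
    filtLen F'' F' n + filtLen F' F n - filtLen F'' F n =
      ((relLen ((satFiltration 𝔪 F'' F ⊔ F').N n) ((satFiltration 𝔪 F' F).N n)).toNat : ℤ) := by
  have e1 := toNat_relLen_add (K₁ := F''.N n) (K₂ := (satFiltration 𝔪 F'' F').N n)
    (K₃ := (satFiltration 𝔪 F'' F).N n) (le_satFiltration 𝔪 h₁ n)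
    (inf_le_inf_right _ (h₂ n)) (hF.relLen_satFiltration_ne_top F'' n)
  have e2 := toNat_relLen_add (K₁ := F'.N n) (K₂ := (satFiltration 𝔪 F'' F ⊔ F').N n)
    (K₃ := (satFiltration 𝔪 F' F).N n) le_sup_right
    (sup_le (inf_le_inf_left _ (satur_mono 𝔪 (h₁ n))) (le_satFiltration 𝔪 h₂ n))
    (hF.relLen_satFiltration_ne_top F' n)
  have e3 : relLen ((satFiltration 𝔪 F'' F').N n) ((satFiltration 𝔪 F'' F).N n) =
      relLen (F'.N n) ((satFiltration 𝔪 F'' F ⊔ F').N n) := by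
    have : (satFiltration 𝔪 F'' F').N n = F'.N n ⊓ (satFiltration 𝔪 F'' F).N n := by
      change F'.N n ⊓ _ = F'.N n ⊓ (F.N n ⊓ _)
      rw [← inf_assoc, inf_eq_left.2 (h₂ n)]
    rw [this, relLen_inf_left]
    exact (relLen_sup_right _ _).symm
  rw [e3] at e1
  change ((relLen (F''.N n) ((satFiltration 𝔪 F'' F').N n)).toNat : ℤ) +
    ((relLen (F'.N n) ((satFiltration 𝔪 F' F).N n)).toNat : ℤ) -
    ((relLen (F''.N n) ((satFiltration 𝔪 F'' F).N n)).toNat : ℤ) = _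
  rw [e1, e2]
  ring

theorem evPoly_filtLen_add_sub {e : ℕ} {F'' F' F : I.Filtration M} (h₁ : F'' ≤ F') (h₂ : F' ≤ F)
    (hF : F.Stable)
    (hd : ringKrullDim (reesAlgebra I ⧸ annIdeal F'' F) ≤ ((e + 1 : ℕ) : WithBot ℕ∞)) :
    EvPoly e fun n => filtLen F'' F' n + filtLen F' F n - filtLen F'' F n := by
  simp only [filtLen_add_sub h₁ h₂ hF]
  set A := satFiltration 𝔪 F'' F' with hA
  set B := satFiltration 𝔪 F'' F with hB
  set C := satFiltration 𝔪 F' F with hC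
  have hBC : B ⊔ F' ≤ C := fun n => sup_le (inf_le_inf_left _ (satur_mono 𝔪 (h₁ n)))
    (le_satFiltration 𝔪 h₂ n)
  obtain ⟨k, hk⟩ := hF.exists_pow_smul_satFiltration_le 𝔪 F'
  obtain ⟨l, hl⟩ := (hF.of_le h₂).exists_pow_smul_satFiltration_le 𝔪 F''
  obtain ⟨x, hx𝔪, hx⟩ := (hF.of_le h₂).exists_regular (F' := A) 𝔪 fun n y hy h => by
    refine ⟨hy, (mem_satur _ _ _).2 ⟨l + 1, fun r hr => ?_⟩⟩
    rw [pow_succ] at hr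
    refine Submodule.smul_induction_on (p := fun r => r • y ∈ F''.N n) hr (fun s hs t ht => ?_)
      fun s t hs ht => by rw [add_smul]; exact add_mem hs ht
    rw [smul_eq_mul, mul_smul]
    exact hl n (Submodule.smul_mem_smul hs (h t ht))
  have hxk : ∀ j n, ∀ y ∈ F'.N n, x ^ j • y ∈ A.N n → y ∈ A.N n := by
    intro j
    induction j with
    | zero => intro n y _ h; simpa using h
    | succ j ih =>
      intro n y hy h
      rw [pow_succ', mul_smul] at h
      exact ih n y hy (hx n _ (Submodule.smul_mem _ _ hy) h)
  have hle : annIdeal A F' ≤ annIdeal (B ⊔ F') C := by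
    intro r hr i n c hc
    refine Submodule.mem_sup_left ⟨F.coeff_smul_mem r i hc.1, (mem_satur _ _ _).2
      ⟨k + l, fun s hs => ?_⟩⟩
    rw [add_comm, pow_add] at hs
    refine Submodule.smul_induction_on
      (p := fun s => s • (r : Polynomial R).coeff i • c ∈ F''.N (n + i)) hs (fun s hs t ht => ?_)
      fun s t hs ht => by rw [add_smul]; exact add_mem hs ht
    rw [smul_eq_mul, mul_smul, smul_comm t]
    exact hl _ (Submodule.smul_mem_smul hs (hr i n _ (hk n (Submodule.smul_mem_smul ht hc))))
  have hone : x ^ k ∈ I ^ 0 := by simp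
  have h3 := ringKrullDim_quotient_add_one_le hle (x := reesMonomial 0 (x ^ k) hone)
    (reesMonomial_mem_annIdeal hone fun n y hy => Submodule.mem_sup_right
      (hk n (Submodule.smul_mem_smul (Ideal.pow_mem_pow hx𝔪 k) hy)))
    fun r hr => mem_annIdeal_of_reesMonomial_mul hone (fun n y hy h => hxk k n y hy h) r hr
  refine evPoly_relLen e (B ⊔ F') C hBC (hF.of_le (satFiltration_le 𝔪 F' F)) (fun n => ?_) ?_
  · exact (relLen_ne_top_of_le (K₁ := F'.N n) le_sup_right (hBC n)
      (hF.relLen_satFiltration_ne_top F' n)).2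
  · have h4 := h3.trans ((ringKrullDim_quotient_mono
      (annIdeal_mono (le_satFiltration 𝔪 h₁) h₂)).trans hd)
    rw [Nat.cast_add, Nat.cast_one] at h4
    exact ENat.WithBot.add_le_add_one_right_iff.1 h4

end Additivity

section ModuleAdditivity
variable {R : Type*} [CommRing R] {I : Ideal R}
variable {M : Type*} [AddCommGroup M] [Module R M]

/-- The filtration `n ↦ F.N (n + j)`. -/
def shiftFiltration (j : ℕ) (F : I.Filtration M) : I.Filtration M where
  N n := F.N (n + j)
  mono n := by rw [add_right_comm]; exact F.mono (n + j)
  smul_le n := by rw [add_right_comm]; exact F.smul_le (n + j)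

theorem shiftFiltration_le (j : ℕ) (F : I.Filtration M) : shiftFiltration j F ≤ F :=
  fun n => F.antitone (Nat.le_add_right n j)

variable {L N : Type*} [AddCommGroup L] [Module R L] [AddCommGroup N] [Module R N]

section Local

variable [IsLocalRing R]

local notation "𝔪" => IsLocalRing.maximalIdeal R

theorem grLen_eq_filtLen_range (f : L →ₗ[R] M) (hf : Function.Injective f) (n : ℕ) :
    grLen 𝔪 I L n = filtLen (shiftFiltration 1 (I.stableFiltration (LinearMap.range f)))
      (I.stableFiltration (LinearMap.range f)) n := by
  have h : ∀ m, (I ^ m • LinearMap.range f : Submodule R M) =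
      (I ^ m • ⊤ : Submodule R L).map f := fun m => by
    rw [Submodule.map_smul'', Submodule.map_top]
  change _ = ((satLen 𝔪 (I ^ (n + 1) • LinearMap.range f : Submodule R M)
    (I ^ n • LinearMap.range f)).toNat : ℤ)
  rw [h, h, satLen_map, Submodule.comap_map_eq_of_injective hf, grLen]

theorem grLen_eq_filtLen_ker (g : M →ₗ[R] N) (hg : Function.Surjective g) (n : ℕ) :
    grLen 𝔪 I N n = filtLen ((I.stableFiltration ⊤ ⊓ I.trivialFiltration (LinearMap.ker g)) ⊔
      shiftFiltration 1 (I.stableFiltration ⊤)) (I.stableFiltration (⊤ : Submodule R M)) n := by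
  have h : ∀ m, (I ^ m • ⊤ : Submodule R N) = (I ^ m • ⊤ : Submodule R M).map g := fun m => by
    rw [Submodule.map_smul'', Submodule.map_top, LinearMap.range_eq_top.2 hg]
  change _ = ((satLen 𝔪 (((I ^ n • ⊤ : Submodule R M) ⊓ LinearMap.ker g) ⊔ I ^ (n + 1) • ⊤)
    (I ^ n • ⊤)).toNat : ℤ)
  rw [grLen, h, h, satLen_map, Submodule.comap_map_eq, ← satLen_inf_left]
  congr 3
  rw [sup_inf_assoc_of_le _ (Submodule.smul_mono_left (Ideal.pow_le_pow_right (Nat.le_succ n))),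
    inf_comm, sup_comm]

end Local

variable [IsNoetherianRing R] [IsLocalRing R] [Module.Finite R M]

local notation "𝔪" => IsLocalRing.maximalIdeal R

theorem evPoly_filtLen_shift_sub {e : ℕ} (hM : mDim R M ≤ ((e + 1 : ℕ) : WithBot ℕ∞))
    {G' G : I.Filtration M} (hG : G.Stable) (h : G' ≤ G) (h' : shiftFiltration 1 G ≤ G') :
    EvPoly e fun n =>
      filtLen (shiftFiltration 1 G) G n - filtLen (shiftFiltration 1 G') G' n := by
  have h'' : shiftFiltration 1 G' ≤ shiftFiltration 1 G := fun n => h (n + 1)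
  have e1 := evPoly_filtLen_add_sub h' h hG
    ((ringKrullDim_quotient_annIdeal_le fun n => G.smul_le n).trans hM)
  have e2 := evPoly_filtLen_add_sub h'' h' (hG.of_le h)
    ((ringKrullDim_quotient_annIdeal_le fun n => G'.smul_le n).trans hM)
  have e3 : EvPoly (e + 1) (filtLen G' G) := evPoly_filtLen h hG
    ((ringKrullDim_quotient_annIdeal_le fun n => (G.smul_le n).trans (h' n)).trans hM)
  refine ((e2.sub e1).sub e3).congr (Eventually.of_forall fun n => ?_)
  have : filtLen (shiftFiltration 1 G') (shiftFiltration 1 G) n = filtLen G' G (n + 1) := rfl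
  simp only [this]
  ring

theorem evPoly_filtLen_shift_sub_of_shift_le {e : ℕ}
    (hM : mDim R M ≤ ((e + 1 : ℕ) : WithBot ℕ∞))
    {K H : I.Filtration M} (hH : H.Stable) (hKH : K ≤ H) {c : ℕ} (hc : shiftFiltration c H ≤ K) :
    EvPoly e fun n =>
      filtLen (shiftFiltration 1 H) H n - filtLen (shiftFiltration 1 K) K n := by
  have key : ∀ j, EvPoly e fun n => filtLen (shiftFiltration 1 H) H n -
      filtLen (shiftFiltration 1 (K ⊔ shiftFiltration j H)) (K ⊔ shiftFiltration j H) n := by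
    intro j
    induction j with
    | zero =>
      have : K ⊔ shiftFiltration 0 H = H := by
        ext1
        exact sup_eq_right.2 hKH
      rw [this]
      simp only [sub_self]
      exact EvPoly.zero e
    | succ j ih =>
      have h1 := evPoly_filtLen_shift_sub hM (G := K ⊔ shiftFiltration j H)
        (G' := K ⊔ shiftFiltration (j + 1) H)
        (hH.of_le fun n => sup_le (hKH n) (shiftFiltration_le j H n))
        (fun n => sup_le_sup_left (H.mono (n + j)) _)
        (fun n => sup_le_sup (K.mono n) (H.antitone (by omega)))
      refine (ih.add h1).congr (Eventually.of_forall fun n => ?_)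
      ring
  have : K ⊔ shiftFiltration c H = K := by
    ext1
    exact sup_eq_left.2 hc
  exact this ▸ key c

theorem evPoly_grLen_of_exact {e : ℕ} (hM : mDim R M ≤ ((e + 1 : ℕ) : WithBot ℕ∞))
    (f : L →ₗ[R] M) (g : M →ₗ[R] N) (hf : Function.Injective f) (hg : Function.Surjective g)
    (hfg : Function.Exact f g) :
    EvPoly e fun n => grLen 𝔪 I L n + grLen 𝔪 I N n - grLen 𝔪 I M n := by
  set S := I.stableFiltration (⊤ : Submodule R M) with hS
  set H := S ⊓ I.trivialFiltration (LinearMap.ker g) with hH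
  set K := I.stableFiltration (LinearMap.range f) with hK
  have hSs : S.Stable := I.stableFiltration_stable ⊤
  have hHS : H ≤ S := fun n => inf_le_left
  have hker := LinearMap.exact_iff.1 hfg
  have hKH : K ≤ H := fun n => le_inf (Submodule.smul_mono le_rfl le_top)
    (Submodule.smul_le_right.trans hker.ge)
  obtain ⟨c, hc⟩ := I.exists_pow_inf_eq_pow_smul (LinearMap.ker g)
  have hcK : shiftFiltration c H ≤ K := fun n => by
    change (I ^ (n + c) • ⊤ : Submodule R M) ⊓ LinearMap.ker g ≤ I ^ n • LinearMap.range f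
    rw [hc _ (Nat.le_add_left c n), Nat.add_sub_cancel, ← hker]
    exact Submodule.smul_mono le_rfl inf_le_right
  have e1 := evPoly_filtLen_add_sub (F'' := shiftFiltration 1 S) (F' := H ⊔ shiftFiltration 1 S)
    (F := S) (fun n => le_sup_right) (fun n => sup_le (hHS n) (S.mono n)) hSs
    ((ringKrullDim_quotient_annIdeal_le fun n => S.smul_le n).trans hM)
  have e2 := evPoly_filtLen_shift_sub_of_shift_le hM (hSs.of_le hHS) hKH hcK
  refine (e1.sub e2).congr (Eventually.of_forall fun n => ?_)
  have h1 : filtLen (shiftFiltration 1 S) (H ⊔ shiftFiltration 1 S) n =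
      filtLen (shiftFiltration 1 H) H n := by
    change ((satLen 𝔪 (S.N (n + 1)) (H.N n ⊔ S.N (n + 1))).toNat : ℤ) =
      ((satLen 𝔪 (S.N (n + 1) ⊓ LinearMap.ker g) (H.N n)).toNat : ℤ)
    rw [satLen_sup_right, ← satLen_inf_left, ← satLen_inf_left _ (S.N (n + 1) ⊓ LinearMap.ker g)]
    congr 3
    change S.N (n + 1) ⊓ (S.N n ⊓ LinearMap.ker g) =
      S.N (n + 1) ⊓ LinearMap.ker g ⊓ (S.N n ⊓ LinearMap.ker g)
    rw [inf_assoc, inf_left_comm (LinearMap.ker g), inf_idem]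
  have h2 : grLen 𝔪 I M n = filtLen (shiftFiltration 1 S) S n := rfl
  rw [grLen_eq_filtLen_range f hf, grLen_eq_filtLen_ker g hg, h2]
  simp only [h1]
  ring

end ModuleAdditivity

section Localization
variable {R : Type*} [CommRing R]
variable {L M N : Type*} [AddCommGroup L] [Module R L] [AddCommGroup M] [Module R M]
  [AddCommGroup N] [Module R N]

/-- The length of the localization of a module at a prime. -/
def locLen (p : PrimeSpectrum R) (M : Type*) [AddCommGroup M] [Module R M] : ℕ∞ :=
  Module.length (Localization.AtPrime p.asIdeal) (LocalizedModule p.asIdeal.primeCompl M)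

theorem locLen_of_exact (p : PrimeSpectrum R) (f : L →ₗ[R] M) (g : M →ₗ[R] N)
    (hf : Function.Injective f) (hg : Function.Surjective g) (hfg : Function.Exact f g) :
    locLen p M = locLen p L + locLen p N :=
  Module.length_eq_add_of_exact (LocalizedModule.map p.asIdeal.primeCompl f)
    (LocalizedModule.map p.asIdeal.primeCompl g) (LocalizedModule.map_injective _ f hf)
    (LocalizedModule.map_surjective _ g hg) (LocalizedModule.map_exact _ f g hfg)

theorem locLen_congr (p : PrimeSpectrum R) (e : M ≃ₗ[R] N) : locLen p M = locLen p N := by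
  have h := locLen_of_exact p (0 : PUnit →ₗ[R] M) (e : M →ₗ[R] N)
    (Function.injective_of_subsingleton _) e.surjective
    ((LinearMap.exact_zero_iff_injective PUnit (e : M →ₗ[R] N)).2 e.injective)
  rw [h, locLen, Module.length_eq_zero, zero_add]

theorem locLen_ne_zero_iff (p : PrimeSpectrum R) [Module.Finite R M] :
    locLen p M ≠ 0 ↔ Module.annihilator R M ≤ p.asIdeal := by
  rw [← Module.mem_support_iff_of_finite, Module.mem_support_iff, ← not_subsingleton_iff_nontrivial,
    locLen, Ne, Module.length_eq_zero_iff]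

theorem locLen_quotient_self (p : PrimeSpectrum R) : locLen p (R ⧸ p.asIdeal) = 1 := by
  rw [locLen, Module.length_eq_one_iff, isSimpleModule_iff_toSpanSingleton_surjective]
  constructor
  · rw [← Module.mem_support_iff, Module.mem_support_iff_of_finite, Ideal.annihilator_quotient]
  · intro x hx y
    induction x with | _ m s
    induction y with | _ m' s'
    obtain ⟨r, rfl⟩ := Ideal.Quotient.mk_surjective m
    obtain ⟨r', rfl⟩ := Ideal.Quotient.mk_surjective m'
    have hr : r ∈ p.asIdeal.primeCompl := fun h => hx <| by
      rw [Ideal.Quotient.eq_zero_iff_mem.2 h, LocalizedModule.zero_mk]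
    refine ⟨Localization.mk (r' * s) (⟨r, hr⟩ * s'), ?_⟩
    rw [LinearMap.toSpanSingleton_apply, LocalizedModule.mk_smul_mk, LocalizedModule.mk_eq]
    refine ⟨1, ?_⟩
    simp only [Submonoid.smul_def, Submonoid.coe_mul, one_smul]
    simp only [Algebra.smul_def, Ideal.Quotient.algebraMap_eq, ← map_mul]
    congr 1
    ring

theorem ringKrullDim_quotient_add_one_le_of_lt {p q : Ideal R} [q.IsPrime] (h : q < p) :
    ringKrullDim (R ⧸ p) + 1 ≤ ringKrullDim (R ⧸ q) := by
  obtain ⟨x, hx, hxq⟩ := SetLike.exists_of_lt h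
  exact ringKrullDim_quotient_add_one_le h.le hx fun r hr =>
    (Ideal.IsPrime.mem_or_mem ‹_› hr).resolve_left hxq

theorem mem_minimalPrimes_of_ringKrullDim_eq {J : Ideal R} {d : ℕ}
    (hJ : ringKrullDim (R ⧸ J) ≤ (d : WithBot ℕ∞)) {p : Ideal R} [p.IsPrime] (hp : J ≤ p)
    (hpd : ringKrullDim (R ⧸ p) = d) : p ∈ J.minimalPrimes := by
  obtain ⟨q, hq, hqp⟩ := Ideal.exists_minimalPrimes_le hp
  rcases hqp.eq_or_lt with rfl | hlt
  · exact hq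
  · have := hq.1.1
    have h := (ringKrullDim_quotient_add_one_le_of_lt hlt).trans
      ((ringKrullDim_quotient_mono hq.1.2).trans hJ)
    rw [hpd, ENat.WithBot.add_one_le_natCast_iff] at h
    exact absurd h (lt_irrefl _)

theorem finite_setOf_mem_minimalPrimes [IsNoetherianRing R] (J : Ideal R) :
    {p : PrimeSpectrum R | p.asIdeal ∈ J.minimalPrimes}.Finite :=
  (Ideal.finite_minimalPrimes_of_isNoetherianRing R J).preimage
    fun _ _ _ _ h => PrimeSpectrum.ext h

end Localization

section Associativity
variable {R : Type*} [CommRing R]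

theorem mDim_quotient (p : Ideal R) : mDim R (R ⧸ p) = ringKrullDim (R ⧸ p) := by
  rw [mDim, Ideal.annihilator_quotient]

theorem jMult_eq_of_tendsto {J I : Ideal R} {e : ℕ} {M : Type*} [AddCommGroup M] [Module R M] {c : ℝ}
    (h : Tendsto (fun n : ℕ => (e.factorial : ℝ) / (n : ℝ) ^ e * (grLen J I M n : ℝ)) atTop
      (nhds c)) : jMult J I M (e + 1) = c := by
  refine Tendsto.limUnder_eq (h.congr fun n => ?_)
  rw [← toNat_mLength_gradedPiece, Nat.add_sub_cancel, Int.cast_natCast]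

variable [IsNoetherianRing R]

theorem hasFiniteSupport_locLen {M : Type*} [AddCommGroup M] [Module R M] [Module.Finite R M]
    {d : ℕ} (hM : mDim R M ≤ (d : WithBot ℕ∞)) (w : PrimeSpectrum R → ℤ) :
    Function.HasFiniteSupport fun p : PrimeSpectrum R =>
      open Classical in if ringKrullDim (R ⧸ p.asIdeal) = d then ((locLen p M).toNat : ℤ) * w p
        else 0 := by
  refine (finite_setOf_mem_minimalPrimes (Module.annihilator R M)).subset fun p hp => ?_
  rw [Function.mem_support] at hp
  split_ifs at hp with h
  · refine mem_minimalPrimes_of_ringKrullDim_eq hM ((locLen_ne_zero_iff p).1 fun h0 => hp ?_) h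
    rw [h0, ENat.toNat_zero, Nat.cast_zero, zero_mul]
  · exact absurd rfl hp

variable [IsLocalRing R]

local notation "𝔪" => IsLocalRing.maximalIdeal R

/-- The expected leading part of the Hilbert function of `M`. -/
def locSum (I : Ideal R) (d : ℕ) (M : Type*) [AddCommGroup M] [Module R M] (n : ℕ) : ℤ :=
  ∑ᶠ p : PrimeSpectrum R, open Classical in
    if ringKrullDim (R ⧸ p.asIdeal) = d then
      ((locLen p M).toNat : ℤ) * grLen 𝔪 I (R ⧸ p.asIdeal) n else 0

theorem evPoly_grLen (I : Ideal R) (d : ℕ) (M : Type*) [AddCommGroup M] [Module R M]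
    [Module.Finite R M] (hM : mDim R M ≤ (d : WithBot ℕ∞)) :
    EvPoly d (grLen 𝔪 I M) := by
  have h := evPoly_filtLen (d := d) (F' := shiftFiltration 1 (I.stableFiltration ⊤))
    (shiftFiltration_le 1 _) (I.stableFiltration_stable (⊤ : Submodule R M))
    ((ringKrullDim_quotient_annIdeal_le fun n => Ideal.Filtration.smul_le _ n).trans hM)
  exact h.congr (Eventually.of_forall fun n => rfl)

theorem evPoly_grLen_sub_locSum_of_equiv_quotient (I : Ideal R) (e : ℕ) {N : Type*}
    [AddCommGroup N] [Module R N] [Module.Finite R N] (q : PrimeSpectrum R)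
    (eq : N ≃ₗ[R] R ⧸ q.asIdeal) (hN : mDim R N ≤ ((e + 1 : ℕ) : WithBot ℕ∞)) :
    (∀ p : PrimeSpectrum R, ringKrullDim (R ⧸ p.asIdeal) = (e + 1 : ℕ) → locLen p N ≠ ⊤) ∧
      EvPoly e fun n => grLen 𝔪 I N n - locSum I (e + 1) N n := by
  have hq : ringKrullDim (R ⧸ q.asIdeal) ≤ ((e + 1 : ℕ) : WithBot ℕ∞) := by
    rwa [mDim, eq.annihilator_eq, Ideal.annihilator_quotient] at hN
  have hpq : ∀ p : PrimeSpectrum R, ringKrullDim (R ⧸ p.asIdeal) = (e + 1 : ℕ) →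
      p ≠ q → locLen p N = 0 := by
    intro p hp hne
    by_contra h0
    rw [← Ne, locLen_ne_zero_iff, eq.annihilator_eq, Ideal.annihilator_quotient] at h0
    have := mem_minimalPrimes_of_ringKrullDim_eq hq h0 hp
    rw [Ideal.minimalPrimes_eq_subsingleton_self, Set.mem_singleton_iff] at this
    exact hne (PrimeSpectrum.ext this)
  have hqq : locLen q N = 1 := (locLen_congr q eq).trans (locLen_quotient_self q)
  refine ⟨fun p hp => ?_, ?_⟩
  · by_cases h : p = q
    · rw [h, hqq]
      exact ENat.one_ne_top
    · rw [hpq p hp h]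
      exact ENat.zero_ne_top
  · by_cases hd : ringKrullDim (R ⧸ q.asIdeal) = (e + 1 : ℕ)
    · refine (EvPoly.zero e).congr (Eventually.of_forall fun n => ?_)
      rw [locSum, finsum_eq_single _ q, if_pos hd, hqq, grLen_congr 𝔪 I eq]
      · simp
      · intro p hp
        split_ifs with h
        · rw [hpq p h hp]
          simp
        · rfl
    · have hle : ringKrullDim (R ⧸ q.asIdeal) ≤ (e : WithBot ℕ∞) := by
        rw [← ENat.WithBot.lt_add_one_iff]
        exact lt_of_le_of_ne (by exact_mod_cast hq) (by exact_mod_cast hd)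
      have h1 : EvPoly e (grLen 𝔪 I N) := evPoly_grLen I e N
        (by rwa [mDim, eq.annihilator_eq, Ideal.annihilator_quotient])
      refine h1.congr (Eventually.of_forall fun n => ?_)
      rw [locSum, finsum_eq_zero_of_forall_eq_zero, sub_zero]
      intro p
      split_ifs with h
      · rw [hpq p h fun hp => hd (hp ▸ h)]
        simp
      · rfl

theorem evPoly_grLen_sub_locSum (I : Ideal R) (e : ℕ) (M : Type*) [AddCommGroup M] [Module R M]
    [Module.Finite R M] (hM : mDim R M ≤ ((e + 1 : ℕ) : WithBot ℕ∞)) :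
    (∀ p : PrimeSpectrum R, ringKrullDim (R ⧸ p.asIdeal) = (e + 1 : ℕ) → locLen p M ≠ ⊤) ∧
      EvPoly e fun n => grLen 𝔪 I M n - locSum I (e + 1) M n := by
  revert hM
  refine IsNoetherianRing.induction_on_isQuotientEquivQuotientPrime R (M := M) ‹_›
    (motive := fun N _ _ _ => mDim R N ≤ ((e + 1 : ℕ) : WithBot ℕ∞) →
      (∀ p : PrimeSpectrum R, ringKrullDim (R ⧸ p.asIdeal) = (e + 1 : ℕ) → locLen p N ≠ ⊤) ∧
      EvPoly e fun n => grLen 𝔪 I N n - locSum I (e + 1) N n) ?_ ?_ ?_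
  · intro N _ _ _ _ _
    have h : ∀ p : PrimeSpectrum R, locLen p N = 0 := fun p => Module.length_eq_zero
    refine ⟨fun p _ => by simp [h], (EvPoly.zero e).congr (Eventually.of_forall fun n => ?_)⟩
    have h1 : grLen 𝔪 I N n = 0 := by
      rw [grLen, satLen, relLen_eq_zero (le_of_eq (Subsingleton.elim _ _))]
      rfl
    simp [locSum, h, h1]
  · intro N _ _ _ q eq hN
    exact evPoly_grLen_sub_locSum_of_equiv_quotient I e q eq hN
  · intro L _ _ _ M _ _ _ N _ _ _ f g hf hg hfg ihL ihN hM
    have hL' : mDim R L ≤ ((e + 1 : ℕ) : WithBot ℕ∞) :=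
      (ringKrullDim_quotient_mono (LinearMap.annihilator_le_of_injective f hf)).trans hM
    have hN' : mDim R N ≤ ((e + 1 : ℕ) : WithBot ℕ∞) :=
      (ringKrullDim_quotient_mono (LinearMap.annihilator_le_of_surjective g hg)).trans hM
    obtain ⟨hL, eL⟩ := ihL hL'
    obtain ⟨hN, eN⟩ := ihN hN'
    have hadd := fun p => locLen_of_exact p f g hf hg hfg
    refine ⟨fun p hp => ?_, ?_⟩
    · rw [hadd]
      exact WithTop.add_ne_top.2 ⟨hL p hp, hN p hp⟩
    · refine ((eL.add eN).sub (evPoly_grLen_of_exact (I := I) hM f g hf hg hfg)).congr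
        (Eventually.of_forall fun n => ?_)
      have hs : locSum I (e + 1) M n = locSum I (e + 1) L n + locSum I (e + 1) N n := by
        rw [locSum, locSum, locSum, ← finsum_add_distrib (hasFiniteSupport_locLen hL' _)
          (hasFiniteSupport_locLen hN' _)]
        refine finsum_congr fun p => ?_
        split_ifs with hp
        · rw [hadd, ENat.toNat_add (hL p hp) (hN p hp)]
          push_cast
          ring
        · rw [add_zero]
      simp only [hs]
      ring

theorem tendsto_jMult (I : Ideal R) (e : ℕ) (M : Type*) [AddCommGroup M] [Module R M]
    [Module.Finite R M] (hM : mDim R M ≤ ((e + 1 : ℕ) : WithBot ℕ∞)) :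
    Tendsto (fun n : ℕ => (e.factorial : ℝ) / (n : ℝ) ^ e * (grLen 𝔪 I M n : ℝ)) atTop
      (nhds (jMult 𝔪 I M (e + 1))) := by
  obtain ⟨c, hc, -⟩ := (evPoly_grLen I (e + 1) M hM).exists_tendsto
  rwa [jMult_eq_of_tendsto hc]

theorem jMult_eq_zero (I : Ideal R) (e : ℕ) (M : Type*) [AddCommGroup M] [Module R M]
    [Module.Finite R M] (hM : mDim R M ≤ (e : WithBot ℕ∞)) : jMult 𝔪 I M (e + 1) = 0 := by
  have h := evPoly_grLen I e M hM
  obtain ⟨c, hc, h0⟩ := h.succ.exists_tendsto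
  rw [jMult_eq_of_tendsto hc, h0 h]

open Classical in
theorem jMult_eq_finsum_of_mDim_eq (I : Ideal R) (e : ℕ) (M : Type*) [AddCommGroup M] [Module R M]
    [Module.Finite R M] (hM : mDim R M = ((e + 1 : ℕ) : WithBot ℕ∞)) :
    jMult 𝔪 I M (e + 1) = ∑ᶠ p : PrimeSpectrum R,
      if p.asIdeal ∈ associatedPrimes R M ∧ ringKrullDim (R ⧸ p.asIdeal) = mDim R M then
        ((locLen p M).toNat : ℝ) * jMult 𝔪 I (R ⧸ p.asIdeal) (e + 1) else 0 := by
  obtain ⟨-, hev⟩ := evPoly_grLen_sub_locSum I e M hM.le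
  set s := (finite_setOf_mem_minimalPrimes (Module.annihilator R M)).toFinset with hs
  have hmem : ∀ p : PrimeSpectrum R, p ∈ s ↔ p.asIdeal ∈ (Module.annihilator R M).minimalPrimes :=
    fun p => by rw [hs, Set.Finite.mem_toFinset, Set.mem_ofPred_eq]
  have hsum : ∀ n, locSum I (e + 1) M n = ∑ p ∈ s,
      if ringKrullDim (R ⧸ p.asIdeal) = (e + 1 : ℕ) then
        ((locLen p M).toNat : ℤ) * grLen 𝔪 I (R ⧸ p.asIdeal) n else 0 := by
    intro n
    refine finsum_eq_sum_of_support_subset _ fun p hp => ?_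
    rw [Function.mem_support] at hp
    split_ifs at hp with h
    · refine (hmem p).2 (mem_minimalPrimes_of_ringKrullDim_eq hM.le
        ((locLen_ne_zero_iff p).1 fun h0 => hp ?_) h)
      rw [h0, ENat.toNat_zero, Nat.cast_zero, zero_mul]
    · exact absurd rfl hp
  have hlim : Tendsto (fun n : ℕ => (e.factorial : ℝ) / (n : ℝ) ^ e *
      ((grLen 𝔪 I M n - locSum I (e + 1) M n : ℤ) : ℝ)) atTop
      (nhds (jMult 𝔪 I M (e + 1) - ∑ p ∈ s, if ringKrullDim (R ⧸ p.asIdeal) = (e + 1 : ℕ) then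
        ((locLen p M).toNat : ℝ) * jMult 𝔪 I (R ⧸ p.asIdeal) (e + 1) else 0)) := by
    refine ((tendsto_jMult I e M hM.le).sub (tendsto_finsetSum s
      (f := fun p (n : ℕ) => if ringKrullDim (R ⧸ p.asIdeal) = (e + 1 : ℕ) then ((locLen p M).toNat : ℝ) *
        ((e.factorial : ℝ) / (n : ℝ) ^ e * (grLen 𝔪 I (R ⧸ p.asIdeal) n : ℝ)) else 0)
      fun p _ => ?_)).congr fun n => ?_
    · split_ifs with hp
      · exact (tendsto_jMult I e _ (by rw [mDim_quotient, hp])).const_mul _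
      · exact tendsto_const_nhds
    · rw [hsum]
      push_cast
      rw [mul_sub, Finset.mul_sum]
      congr 1
      refine Finset.sum_congr rfl fun p _ => ?_
      split_ifs
      · ring
      · rw [mul_zero]
  obtain ⟨c, hc, h0⟩ := hev.succ.exists_tendsto
  rw [h0 hev] at hc
  rw [sub_eq_zero.1 (tendsto_nhds_unique hlim hc), finsum_eq_sum_of_support_subset (s := s)]
  · refine Finset.sum_congr rfl fun p hp => ?_
    have hass := Module.associatedPrimes.minimalPrimes_annihilator_subset_associatedPrimes R M
      ((hmem p).1 hp)
    rw [hM]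
    simp only [hass, true_and]
  · intro p hp
    rw [Function.mem_support] at hp
    split_ifs at hp with h
    · exact (hmem p).2 (mem_minimalPrimes_of_ringKrullDim_eq hM.le (Submodule.annihilator_top (R := R) (M := M) ▸ h.1.annihilator_le)
        (h.2.trans hM))
    · exact absurd rfl hp

end Associativity

open Classical in
/-- Theorem 3.9 (associativity/additive formula):
`j_d(I, M) = Σ_{𝔭 ∈ Assh_R M} length_{R_𝔭}(M_𝔭) · j_d(I, R/𝔭)`, where
`Assh_R M = {𝔭 ∈ Ass_R M : dim R/𝔭 = dim_R M}`. -/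
theorem stmt_16 {R : Type*} [CommRing R] [IsNoetherianRing R] [IsLocalRing R]
    (hdim : 0 < ringKrullDim R) (hres : Infinite (IsLocalRing.ResidueField R))
    (I : Ideal R) (hI : I ≠ ⊤)
    (M : Type*) [AddCommGroup M] [Module R M] [Module.Finite R M]
    (d : ℕ) (hd : 0 < d) (hMd : mDim R M ≤ (d : WithBot ℕ∞)) :
    jMult (IsLocalRing.maximalIdeal R) I M d =
      ∑ᶠ p : PrimeSpectrum R,
        if p.asIdeal ∈ associatedPrimes R M ∧
            ringKrullDim (R ⧸ p.asIdeal) = mDim R M then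
          ((mLength (Localization.AtPrime p.asIdeal)
              (LocalizedModule p.asIdeal.primeCompl M)).toNat : ℝ) *
            jMult (IsLocalRing.maximalIdeal R) I (R ⧸ p.asIdeal) d
        else 0 := by
  obtain ⟨e, rfl⟩ := Nat.exists_eq_succ_of_ne_zero hd.ne'
  rcases hMd.eq_or_lt with h | h
  · simp only [mLength_eq]
    exact jMult_eq_finsum_of_mDim_eq I e M h
  · have hle : mDim R M ≤ (e : WithBot ℕ∞) := ENat.WithBot.lt_add_one_iff.1 (by exact_mod_cast h)
    rw [jMult_eq_zero I e M hle, finsum_eq_zero_of_forall_eq_zero]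
    intro p
    split_ifs with hp
    · rw [jMult_eq_zero I e _ (by rw [mDim_quotient, hp.2]; exact hle), mul_zero]
    · rfl

end
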